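/- arXiv:2304.03979 — 6 statements merged into one kernel-verified Lean document; each statement's English description precedes it below -/
import Mathlib

section
/- Let 𝒳 ⊆ A be an operator system and let L : 𝒳 → [0,∞) be a Lipschitz seminorm. The following conditions are equivalent: (1) (𝒳,L) is a compact quantum metric space; (2) (𝒳,L) has finite diameter and for every ε > 0 there exist a unital C*-algebra B, an operator system 𝒴 ⊆ B, and a positive isometric ε-approximation (ι,Φ) of (𝒳,L) with values in 𝒴; (3) (𝒳,L) has finite diameter and there exists a constant C > 0 such that for every ε > 0 there exist a unital C*-algebra B, an operator system 𝒴 ⊆ B, and an (ε,C)-approximation of (𝒳,L) with values in 𝒴. -/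
open scoped ComplexOrder ENNReal NNReal

universe u

/-- The state space `S(𝒳)` of an operator system `𝒳 ⊆ A`: all linear functionals `φ : 𝒳 → ℂ`
with `φ(1) = 1` which are nonnegative on the elements of `𝒳` that are positive in `A`
(positivity in a C*-algebra being expressed algebraically as being of the form `y* y`). -/
def stateSet {A : Type*} [CStarAlgebra A] (X : Submodule ℂ A) (hX_one : (1 : A) ∈ X) :
    Set (X → ℂ) :=
  {φ | (∀ x y : X, φ (x + y) = φ x + φ y) ∧
    (∀ (c : ℂ) (x : X), φ (c • x) = c * φ x) ∧
    φ ⟨1, hX_one⟩ = 1 ∧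
    ∀ x : X, (∃ y : A, (x : A) = star y * y) → 0 ≤ φ x}

/-- The Monge–Kantorovich extended metric associated with a seminorm `L`:
`ρ_L(φ,ψ) = sup{|φ(x) − ψ(x)| : x ∈ 𝒳, L(x) ≤ 1}`, with values in `[0,∞]`. -/
noncomputable def mkDist {A : Type*} [CStarAlgebra A] (X : Submodule ℂ A) (L : A → ℝ)
    (φ ψ : X → ℂ) : ℝ≥0∞ :=
  ⨆ x : {x : X // L (x : A) ≤ 1}, (‖φ x.1 - ψ x.1‖₊ : ℝ≥0∞)

/-- The topology on the state space generated by the open balls of finite radius of the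
Monge–Kantorovich extended metric. -/
noncomputable def mkBallTopology {A : Type*} [CStarAlgebra A] (X : Submodule ℂ A)
    (hX_one : (1 : A) ∈ X) (L : A → ℝ) : TopologicalSpace (stateSet X hX_one) :=
  TopologicalSpace.generateFrom
    {U | ∃ (φ : stateSet X hX_one) (r : ℝ≥0∞), r ≠ ⊤ ∧
      U = {ψ : stateSet X hX_one | mkDist X L (φ : X → ℂ) (ψ : X → ℂ) < r}}

/-- `(𝒳,L)` is a compact quantum metric space when the topology generated by the open
Monge–Kantorovich balls of finite radius coincides with the weak-*-topology (the topology of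
pointwise convergence) on the state space `S(𝒳)`. -/
def IsCQMS {A : Type*} [CStarAlgebra A] (X : Submodule ℂ A) (hX_one : (1 : A) ∈ X)
    (L : A → ℝ) : Prop :=
  mkBallTopology X hX_one L = (inferInstance : TopologicalSpace (stateSet X hX_one))

/-- `(𝒳,L)` has finite diameter: `‖[x]‖_{𝒳/ℂ} ≤ C·L(x)` for some `C ≥ 0` and all `x ∈ 𝒳`,
the quotient norm by the scalars being written as `⨅ c : ℂ, ‖x - c•1‖`. -/
def HasFiniteDiameter {A : Type*} [CStarAlgebra A] (X : Submodule ℂ A) (L : A → ℝ) : Prop :=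
  ∃ C : ℝ, 0 ≤ C ∧ ∀ x ∈ X, (⨅ c : ℂ, ‖x - c • (1 : A)‖) ≤ C * L x

/-- A positive isometric `ε`-approximation `(ι,Φ)` of `(𝒳,L)`: a pair of unital linear maps
into an operator system `𝒴 ⊆ B`, where `ι` is a unital isometry, `Φ` is a unital positive
bounded operator with finite-dimensional image, and `‖ι(x) − Φ(x)‖ ≤ ε·L(x)` on `𝒳`.  The maps
are encoded as linear maps on the ambient C*-algebra `A`; only their restrictions to `𝒳` are
relevant. -/
structure PositiveIsometricApprox {A : Type u} [CStarAlgebra A] (X : Submodule ℂ A)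
    (L : A → ℝ) (ε : ℝ) : Type (u + 1) where
  B : Type u
  [instB : CStarAlgebra B]
  Y : Submodule ℂ B
  one_mem_Y : (1 : B) ∈ Y
  star_mem_Y : ∀ y ∈ Y, star y ∈ Y
  ι : A →ₗ[ℂ] B
  Φ : A →ₗ[ℂ] B
  mem_Y : ∀ x ∈ X, ι x ∈ Y ∧ Φ x ∈ Y
  ι_one : ι 1 = 1
  Φ_one : Φ 1 = 1
  Φ_bounded : ∃ M : ℝ, ∀ x ∈ X, ‖Φ x‖ ≤ M * ‖x‖
  ι_isometric : ∀ x ∈ X, ‖ι x‖ = ‖x‖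
  Φ_positive : ∀ x ∈ X, (∃ y : A, x = star y * y) → ∃ w : B, Φ x = star w * w
  Φ_finite : FiniteDimensional ℂ (Submodule.span ℂ (Φ '' X))
  approx : ∀ x ∈ X, ‖ι x - Φ x‖ ≤ ε * L x

/-- An `(ε,C)`-approximation `(ι,Φ)` of `(𝒳,L)`: a pair of unital bounded linear maps into an
operator system `𝒴 ⊆ B` with `(1/C)·‖x‖ ≤ ‖ι(x)‖` on `𝒳`, the image of `Φ` a
finite-dimensional subspace, and `‖ι(x) − Φ(x)‖ ≤ ε·L(x)` on `𝒳`.  The maps are encoded as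
linear maps on the ambient C*-algebra `A`; only their restrictions to `𝒳` are relevant. -/
structure EpsCApprox {A : Type u} [CStarAlgebra A] (X : Submodule ℂ A)
    (L : A → ℝ) (ε C : ℝ) : Type (u + 1) where
  B : Type u
  [instB : CStarAlgebra B]
  Y : Submodule ℂ B
  one_mem_Y : (1 : B) ∈ Y
  star_mem_Y : ∀ y ∈ Y, star y ∈ Y
  ι : A →ₗ[ℂ] B
  Φ : A →ₗ[ℂ] B
  mem_Y : ∀ x ∈ X, ι x ∈ Y ∧ Φ x ∈ Y
  ι_one : ι 1 = 1
  Φ_one : Φ 1 = 1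
  ι_bounded : ∃ M : ℝ, ∀ x ∈ X, ‖ι x‖ ≤ M * ‖x‖
  Φ_bounded : ∃ M : ℝ, ∀ x ∈ X, ‖Φ x‖ ≤ M * ‖x‖
  ι_below : ∀ x ∈ X, (1 / C) * ‖x‖ ≤ ‖ι x‖
  Φ_finite : FiniteDimensional ℂ (Submodule.span ℂ (Φ '' X))
  approx : ∀ x ∈ X, ‖ι x - Φ x‖ ≤ ε * L x

section

open scoped BoundedContinuousFunction

/-- The C*-algebra of operators on a two-dimensional Hilbert space. -/
abbrev EndTwo := EuclideanSpace ℂ (Fin 2) →L[ℂ] EuclideanSpace ℂ (Fin 2)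

lemma exists_char {A : Type*} [CStarAlgebra A] [Nontrivial A] (a : A) (ha : IsSelfAdjoint a) :
    ∃ f : StrongDual ℂ A, f 1 = 1 ∧ ‖f‖ ≤ 1 ∧ ‖f a‖ = ‖a‖ := by
  have : IsStarNormal a := ha.isStarNormal
  let S := StarAlgebra.elemental ℂ a
  let b : S := ⟨a, StarAlgebra.elemental.self_mem ℂ a⟩
  have hb : IsSelfAdjoint b := Subtype.ext ha
  obtain ⟨z, hz, hz'⟩ := spectrum.exists_nnnorm_eq_spectralRadius b
  rw [hb.spectralRadius_eq_nnnorm] at hz'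
  obtain ⟨χ, hχ⟩ := WeakDual.CharacterSpace.mem_spectrum_iff_exists.1 hz
  have hle : ∀ s : S, ‖χ s‖ ≤ ‖s‖ := fun s => AlgHom.norm_apply_le_self χ s
  let g : StrongDual ℂ (Subalgebra.toSubmodule S.toSubalgebra) :=
    LinearMap.mkContinuous
      ({ toFun := fun s => χ (⟨s.1, s.2⟩ : S), map_add' := fun x y => map_add χ (⟨x.1, x.2⟩ : S) ⟨y.1, y.2⟩,
         map_smul' := fun c y => map_smul χ c (⟨y.1, y.2⟩ : S) }) 1
      (fun x => (hle ⟨x.1, x.2⟩).trans_eq (one_mul _).symm)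
  obtain ⟨f, hf, hfn⟩ := exists_extension_norm_eq _ g
  refine ⟨f, ?_, ?_, ?_⟩
  · rw [show (1 : A) = ((⟨1, one_mem S⟩ : Subalgebra.toSubmodule S.toSubalgebra) : A) from rfl, hf]
    exact map_one χ
  · rw [hfn]
    exact LinearMap.mkContinuous_norm_le _ zero_le_one _
  · rw [show a = ((⟨a, b.2⟩ : Subalgebra.toSubmodule S.toSubalgebra) : A) from rfl, hf]
    change ‖χ b‖ = ‖b‖
    rw [hχ]
    exact congrArg NNReal.toReal (ENNReal.coe_injective hz')

lemma pos_of_norm_le_one {A : Type*} [CStarAlgebra A] [PartialOrder A] [StarOrderedRing A]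
    (f : StrongDual ℂ A) (h1 : f 1 = 1) (hf : ‖f‖ ≤ 1) (h : A) (hh : 0 ≤ h) : 0 ≤ f h := by
  have hsa : IsSelfAdjoint h := hh.isSelfAdjoint
  have bound : ∀ x, ‖f x‖ ≤ ‖x‖ := fun x => by
    simpa using f.le_of_opNorm_le hf x
  rw [Complex.nonneg_iff]
  have A_triv : Nontrivial A := ⟨⟨1, 0, fun e => by simp [e] at h1⟩⟩
  constructor
  · have h2 : ‖algebraMap ℝ A ‖h‖ - h‖ ≤ ‖h‖ := by
      rw [CStarAlgebra.norm_le_iff_le_algebraMap _ (norm_nonneg _)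
        (sub_nonneg.2 hsa.le_algebraMap_norm_self)]
      simpa using hh
    have h3 := (bound _).trans h2
    rw [map_sub, show algebraMap ℝ A ‖h‖ = (‖h‖ : ℂ) • (1 : A) by
      rw [Algebra.algebraMap_eq_smul_one, Complex.coe_smul], map_smul, h1] at h3
    have := (Complex.re_le_norm _).trans h3
    simp at this
    exact this
  · have key : ∀ t : ℝ, ((f h).im + t) ^ 2 ≤ ‖h‖ ^ 2 + t ^ 2 := by
      intro t
      have h4 := bound (h + (t * Complex.I) • (1 : A))
      have h5 : ‖h + (t * Complex.I) • (1 : A)‖ ^ 2 ≤ ‖h‖ ^ 2 + t ^ 2 := by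
        rw [sq, ← CStarRing.norm_star_mul_self]
        have : star (h + (t * Complex.I) • (1 : A)) * (h + (t * Complex.I) • (1 : A))
          = h * h + ((t ^ 2 : ℝ) : ℂ) • (1 : A) := by
          rw [star_add, hsa.star_eq, star_smul]
          simp [mul_add, add_mul, smul_smul]
          have : (t * Complex.I) * (t * Complex.I) = - (t : ℂ)^2 := by
            rw [mul_mul_mul_comm, Complex.I_mul_I]; ring
          rw [this, neg_smul, neg_neg]
        rw [this]
        refine (norm_add_le _ _).trans ?_
        gcongr
        · rw [sq]; exact norm_mul_le _ _
        · rw [norm_smul]; simp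
      have h6 : ‖f (h + (t * Complex.I) • (1 : A))‖ ^ 2 ≤ ‖h‖ ^ 2 + t ^ 2 := by
        refine le_trans ?_ h5
        gcongr
      rw [map_add, map_smul, h1, Complex.sq_norm, Complex.normSq_apply] at h6
      simp at h6
      nlinarith [sq_nonneg (f h).re]
    by_contra hne
    have hne' : (f h).im ≠ 0 := fun e => hne e.symm
    have := key ((‖h‖ ^ 2 + 1) / (2 * (f h).im))
    have h7 : 2 * (f h).im * ((‖h‖ ^ 2 + 1) / (2 * (f h).im)) = ‖h‖ ^ 2 + 1 := by field_simp
    nlinarith [sq_nonneg (f h).im]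

lemma exists_state {A : Type*} [CStarAlgebra A] [PartialOrder A] [StarOrderedRing A] [Nontrivial A] (a : A) (ha : IsSelfAdjoint a) :
    ∃ f : A →ₚ[ℂ] ℂ, f 1 = 1 ∧ ‖f a‖ = ‖a‖ := by
  obtain ⟨f, h1, h2, h3⟩ := exists_char a ha
  exact ⟨PositiveLinearMap.mk₀ f.toLinearMap (fun x hx => pos_of_norm_le_one f h1 h2 x hx), h1, h3⟩

/-- A unital, contractive linear map to `EndTwo` sending positive elements to positive elements. -/
structure IsCompression {A : Type*} [CStarAlgebra A] (φ : A →ₗ[ℂ] EndTwo) : Prop where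
  map_one : φ 1 = 1
  norm_le : ∀ a, ‖φ a‖ ≤ ‖a‖
  pos : ∀ y, ∃ w, φ (star y * y) = star w * w

open ContinuousLinearMap in
lemma isCompression_conj {A : Type*} [CStarAlgebra A] {H : Type*} [NormedAddCommGroup H] [InnerProductSpace ℂ H]
    [CompleteSpace H] (π : A →⋆ₐ[ℂ] (H →L[ℂ] H)) (V : EuclideanSpace ℂ (Fin 2) →ₗᵢ[ℂ] H) :
    ∃ φ : A →ₗ[ℂ] EndTwo, IsCompression φ ∧ ∀ a, φ a = adjoint V.toContinuousLinearMap ∘L π a ∘L V.toContinuousLinearMap := by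
  refine ⟨{ toFun := fun a => adjoint V.toContinuousLinearMap ∘L π a ∘L V.toContinuousLinearMap,
            map_add' := fun x y => by ext; simp
            map_smul' := fun c y => by ext; simp }, ⟨?_, ?_, ?_⟩, fun _ => rfl⟩
  · simp only [LinearMap.coe_mk, AddHom.coe_mk, map_one]
    ext1 v
    refine ext_inner_right ℂ fun w => ?_
    simp [adjoint_inner_left]
  · intro a
    have hV : ‖V.toContinuousLinearMap‖ ≤ 1 := V.norm_toContinuousLinearMap_le
    calc _ ≤ ‖adjoint V.toContinuousLinearMap‖ * ‖π a ∘L V.toContinuousLinearMap‖ := opNorm_comp_le _ _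
      _ ≤ ‖adjoint V.toContinuousLinearMap‖ * (‖π a‖ * ‖V.toContinuousLinearMap‖) := by
        gcongr; exact opNorm_comp_le _ _
      _ ≤ 1 * (‖a‖ * 1) := by
        gcongr
        · simpa only [LinearIsometryEquiv.norm_map] using hV
        · exact NonUnitalStarAlgHom.norm_apply_le π a
      _ = ‖a‖ := by simp
  · intro y
    refine CStarAlgebra.nonneg_iff_eq_star_mul_self.1 ((nonneg_iff_isPositive _).2 ?_)
    have := (isPositive_adjoint_comp_self (π y ∘L V.toContinuousLinearMap))
    convert this using 1
    simp only [LinearMap.coe_mk, AddHom.coe_mk, map_mul, map_star, adjoint_comp, star_eq_adjoint]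
    rfl

lemma isCompression_state {A : Type*} [CStarAlgebra A] [PartialOrder A] [StarOrderedRing A] (f : A →ₚ[ℂ] ℂ)
    (h1 : f 1 = 1) (hf : ∀ a, ‖f a‖ ≤ ‖a‖) : IsCompression (f.toLinearMap.smulRight (1 : EndTwo)) := by
  refine ⟨by simp [h1], fun a => ?_, fun y => ?_⟩
  · simpa [norm_smul] using hf a
  · have h := f.map_nonneg (star_mul_self_nonneg y)
    refine ⟨((Real.sqrt (f (star y * y)).re : ℝ) : ℂ) • 1, ?_⟩
    simp only [star_smul, star_one, smul_mul_smul_comm, mul_one]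
    have h2 := Complex.nonneg_iff.1 h
    have : f (star y * y) = ((f (star y * y)).re : ℂ) := by
      apply Complex.ext <;> simp [h2.2.symm]
    change f (star y * y) • (1 : EndTwo) = _
    congr 1
    rw [RCLike.star_def, Complex.conj_ofReal, ← Complex.ofReal_mul, Real.mul_self_sqrt h2.1]
    exact this

lemma exists_isometry {H : Type*} [NormedAddCommGroup H] [InnerProductSpace ℂ H] (ξ η : H) (hξ : ‖ξ‖ = 1)
   (hne : η ≠ inner ℂ ξ η • ξ) : ∃ (V : EuclideanSpace ℂ (Fin 2) →ₗᵢ[ℂ] H) (v w : EuclideanSpace ℂ (Fin 2)),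
     V v = ξ ∧ V w = η := by
  set u := η - inner ℂ ξ η • ξ with hu
  have hu0 : u ≠ 0 := sub_ne_zero.2 hne
  have hun : ‖u‖ ≠ 0 := norm_ne_zero_iff.2 hu0
  have horth : inner ℂ ξ u = 0 := by
    rw [hu, inner_sub_right, inner_smul_right, inner_self_eq_norm_sq_to_K, hξ]; simp
  obtain ⟨b⟩ : Nonempty (OrthonormalBasis (Fin 2) ℂ (EuclideanSpace ℂ (Fin 2))) :=
    ⟨EuclideanSpace.basisFun (Fin 2) ℂ⟩
  let T := b.toBasis.constr ℂ (![ξ, (‖u‖⁻¹ : ℂ) • u])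
  have hT : ∀ i, T (b i) = ![ξ, (‖u‖⁻¹ : ℂ) • u] i := fun i => by
    have := b.toBasis.constr_basis ℂ (![ξ, (‖u‖⁻¹ : ℂ) • u]) i
    rwa [b.coe_toBasis] at this
  have ho : Orthonormal ℂ (T ∘ b.toBasis) := by
    have : T ∘ b.toBasis = ![ξ, (‖u‖⁻¹ : ℂ) • u] := by
      ext1 i; simpa using hT i
    rw [this]
    have horth' : inner ℂ u ξ = 0 := inner_eq_zero_symm.1 horth
    refine ⟨fun i => ?_, fun i j hij => ?_⟩
    · fin_cases i
      · simpa using hξ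
      · simp [norm_smul, hun]
    · fin_cases i <;> fin_cases j <;> simp [inner_smul_left, inner_smul_right, horth, horth'] at hij ⊢
  refine ⟨T.isometryOfOrthonormal (v := b.toBasis) (by simp [b.orthonormal]) ho, b 0,
    inner ℂ ξ η • b 0 + (‖u‖ : ℂ) • b 1, hT 0, ?_⟩
  have hun' : (‖u‖ : ℂ) ≠ 0 := Complex.ofReal_ne_zero.2 hun
  change T _ = η
  rw [map_add, map_smul, map_smul, hT, hT]
  simp only [Matrix.cons_val_zero, Matrix.cons_val_one, smul_smul, mul_inv_cancel₀ hun', one_smul]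
  rw [hu, add_sub_cancel]

/-- Compressing a GNS representation to a two-dimensional subspace attains the norm of `x`. -/
lemma exists_compression {A : Type*} [CStarAlgebra A] [Nontrivial A] (x : A) :
    ∃ φ : A →ₗ[ℂ] EndTwo, IsCompression φ ∧ ‖x‖ ≤ ‖φ x‖ := by
  let _ := CStarAlgebra.spectralOrder A
  have := CStarAlgebra.spectralOrderedRing A
  obtain ⟨f, h1, hf⟩ := exists_state (star x * x) (IsSelfAdjoint.star_mul_self x)
  rw [CStarRing.norm_star_mul_self] at hf
  let ξ : f.GNS := (f.toPreGNS 1 : f.GNS)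
  have hξ : ‖ξ‖ = 1 := by
    rw [UniformSpace.Completion.norm_coe, f.preGNS_norm_def]; simp [h1]
  have hη : ‖f.gnsStarAlgHom x ξ‖ = ‖x‖ := by
    have : f.gnsStarAlgHom x ξ = (f.toPreGNS x : f.GNS) := by
      simp [ξ]
    rw [this, UniformSpace.Completion.norm_coe]
    have h2 := f.preGNS_norm_sq (f.toPreGNS x)
    have h3 := congrArg norm h2
    simp only [PositiveLinearMap.ofPreGNS_toPreGNS, hf] at h3
    simp at h3
    nlinarith [norm_nonneg x, norm_nonneg (f.toPreGNS x)]
  have hin : ∀ a, inner ℂ ξ (f.gnsStarAlgHom a ξ) = f a := by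
    intro a
    have : f.gnsStarAlgHom a ξ = (f.toPreGNS a : f.GNS) := by
      simp [ξ]
    rw [this, UniformSpace.Completion.inner_coe, f.preGNS_inner_def]
    simp
  by_cases hne : f.gnsStarAlgHom x ξ = inner ℂ ξ (f.gnsStarAlgHom x ξ) • ξ
  · refine ⟨_, isCompression_state f h1 fun a => ?_, ?_⟩
    · rw [← hin]
      calc _ ≤ ‖ξ‖ * ‖f.gnsStarAlgHom a ξ‖ := norm_inner_le_norm _ _
        _ ≤ ‖ξ‖ * (‖f.gnsStarAlgHom a‖ * ‖ξ‖) := by gcongr; exact ContinuousLinearMap.le_opNorm _ _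
        _ ≤ ‖a‖ := by
          rw [hξ, one_mul, mul_one]; exact NonUnitalStarAlgHom.norm_apply_le f.gnsStarAlgHom a
    · rw [hin] at hne
      rw [← hη, hne, norm_smul, hξ]
      simp [norm_smul]
  · obtain ⟨V, v, w, hv, hw⟩ := exists_isometry ξ _ hξ hne
    obtain ⟨φ, hφ, hφe⟩ := isCompression_conj f.gnsStarAlgHom V
    refine ⟨φ, hφ, ?_⟩
    have h4 : φ x v = w := by
      rw [hφe]
      refine ext_inner_right ℂ fun z => ?_
      simp only [ContinuousLinearMap.comp_apply, ContinuousLinearMap.adjoint_inner_left]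
      simp only [LinearIsometry.coe_toContinuousLinearMap, hv]
      rw [← hw, V.inner_map_map]
    have h5 := (φ x).le_opNorm v
    rwa [h4, ← V.norm_map v, ← V.norm_map w, hv, hw, hη, hξ, mul_one] at h5

/-- The Lipschitz unit ball is totally bounded modulo scalars. -/
def LipschitzBallTotallyBounded {A : Type*} [CStarAlgebra A] (X : Submodule ℂ A) (L : A → ℝ) : Prop :=
  ∀ ε : ℝ, 0 < ε → ∃ F : Set A, F.Finite ∧ F ⊆ X ∧
    ∀ x ∈ X, L x ≤ 1 → ∃ y ∈ F, ∃ c : ℂ, ‖x - y - c • (1 : A)‖ ≤ ε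

lemma exists_finite_net {α V : Type*} [NormedAddCommGroup V] [NormedSpace ℂ V] [FiniteDimensional ℂ V]
    (g : α → V) (S : Set α) (M : ℝ) (hM : ∀ x ∈ S, ‖g x‖ ≤ M) {ε : ℝ} (hε : 0 < ε) :
    ∃ F : Set α, F.Finite ∧ F ⊆ S ∧ ∀ x ∈ S, ∃ y ∈ F, ‖g x - g y‖ ≤ ε := by
  have : ProperSpace V := FiniteDimensional.proper ℂ V
  have hb : TotallyBounded (g '' S) := by
    refine (isCompact_closedBall (0 : V) M).totallyBounded.subset ?_
    rintro _ ⟨x, hx, rfl⟩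
    simpa using hM x hx
  obtain ⟨t, ht, hfin, hcov⟩ := Metric.finite_approx_of_totallyBounded hb ε hε
  obtain ⟨F, hFS, hF, rfl⟩ := Set.exists_subset_image_finite_and.1 ⟨t, ht, hfin, rfl⟩
  refine ⟨F, hF, hFS, fun x hx => ?_⟩
  have := hcov ⟨x, hx, rfl⟩
  simp only [Set.mem_iUnion, Set.mem_image, Metric.mem_ball, dist_eq_norm] at this
  obtain ⟨_, ⟨y, hy, rfl⟩, hxy⟩ := this
  exact ⟨y, hy, hxy.le⟩

lemma le_mul_of_le_of_le_one {A : Type*} [CStarAlgebra A] (X : Submodule ℂ A) (L : A → ℝ)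
    (hL_nonneg : ∀ x ∈ X, 0 ≤ L x) (hL_smul : ∀ (c : ℂ), ∀ x ∈ X, L (c • x) = ‖c‖ * L x)
    (p : A → ℝ) (hp : ∀ s : ℝ, 0 < s → ∀ x, p x ≤ s * p (((s⁻¹ : ℝ) : ℂ) • x)) (M : ℝ) (hM : 0 ≤ M)
    (h : ∀ x ∈ X, L x ≤ 1 → p x ≤ M) : ∀ x ∈ X, p x ≤ M * L x := by
  intro x hx
  refine le_of_forall_pos_le_add fun η hη => ?_
  have hs : 0 < L x + η / (M + 1) := add_pos_of_nonneg_of_pos (hL_nonneg x hx) (by positivity)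
  have h1 := hp _ hs x
  have h2 : p ((((L x + η / (M + 1))⁻¹ : ℝ) : ℂ) • x) ≤ M := by
    refine h _ (X.smul_mem _ hx) ?_
    rw [hL_smul _ _ hx, Complex.norm_real, Real.norm_of_nonneg (by positivity), inv_mul_le_iff₀ hs]
    have : 0 < η / (M + 1) := by positivity
    linarith
  calc p x ≤ (L x + η / (M + 1)) * M := h1.trans (by gcongr)
    _ = M * L x + η * (M / (M + 1)) := by ring
    _ ≤ M * L x + η * 1 := by
      gcongr
      rw [div_le_one (by positivity)]; linarith
    _ = _ := by ring

lemma LipschitzBallTotallyBounded.hasFiniteDiameter {A : Type*} [CStarAlgebra A] {X : Submodule ℂ A} {L : A → ℝ}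
    (hL_nonneg : ∀ x ∈ X, 0 ≤ L x) (hL_smul : ∀ (c : ℂ), ∀ x ∈ X, L (c • x) = ‖c‖ * L x)
    (h : LipschitzBallTotallyBounded X L) : HasFiniteDiameter X L := by
  obtain ⟨F, hF, -, hcov⟩ := h 1 one_pos
  obtain ⟨M, hM⟩ := hF.isBounded.exists_norm_le
  have hbdd : ∀ x : A, BddBelow (Set.range fun c : ℂ => ‖x - c • (1 : A)‖) := fun x =>
    ⟨0, by rintro _ ⟨c, rfl⟩; exact norm_nonneg _⟩
  refine ⟨1 + |M|, by positivity, le_mul_of_le_of_le_one X L hL_nonneg hL_smul _ ?_ _ (by positivity) ?_⟩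
  · intro s hs x
    rw [Real.mul_iInf_of_nonneg hs.le]
    refine le_ciInf fun c => (ciInf_le (hbdd x) ((s : ℂ) * c)).trans_eq ?_
    have : x - ((s : ℂ) * c) • (1 : A) = (s : ℂ) • (((s⁻¹ : ℝ) : ℂ) • x - c • (1 : A)) := by
      rw [smul_sub, smul_smul, smul_smul, ← Complex.ofReal_mul, mul_inv_cancel₀ hs.ne', Complex.ofReal_one, one_smul]
    rw [this, norm_smul, Complex.norm_real, Real.norm_of_nonneg hs.le]
  · intro x hx hLx
    obtain ⟨y, hy, c, hc⟩ := hcov x hx hLx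
    refine (ciInf_le (hbdd x) c).trans ?_
    have : x - c • (1 : A) = (x - y - c • (1 : A)) + y := by abel
    rw [this]
    exact (norm_add_le _ _).trans (add_le_add hc ((hM y hy).trans (le_abs_self M)))

lemma lipschitzBallTotallyBounded_of_approx {A : Type u} [CStarAlgebra A] {X : Submodule ℂ A} (hX_one : (1 : A) ∈ X) {L : A → ℝ}
    (hL_add : ∀ x ∈ X, ∀ y ∈ X, L (x + y) ≤ L x + L y)
    (hL_smul : ∀ (c : ℂ), ∀ x ∈ X, L (c • x) = ‖c‖ * L x) (hL_one : L (1 : A) = 0)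
    (hD : HasFiniteDiameter X L) {C : ℝ} (hC : 0 < C) (h : ∀ ε : ℝ, 0 < ε → Nonempty (EpsCApprox X L ε C)) :
    LipschitzBallTotallyBounded X L := by
  intro ε hε
  obtain ⟨D, hD0, hD⟩ := hD
  obtain ⟨⟨B, Y, -, -, ι, Φ, -, -, -, -, ⟨M, hM⟩, hι, hfin, happ⟩⟩ := h (ε / (3 * C)) (by positivity)
  let S : Set A := {x | x ∈ X ∧ L x ≤ 1 ∧ ‖x‖ ≤ D + 1}
  let P : Submodule ℂ B := Submodule.span ℂ (Φ '' X)
  have hP : ∀ x ∈ X, Φ x ∈ P := fun x hx => Submodule.subset_span ⟨x, hx, rfl⟩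
  obtain ⟨F, hF, hFS, hcov⟩ := exists_finite_net (V := P) (fun x : X => ⟨Φ x, hP x x.2⟩) {x | (x : A) ∈ S}
    (|M| * (D + 1)) (fun x hx => by
      change ‖Φ x‖ ≤ _
      refine (hM x x.2).trans ?_
      exact mul_le_mul (le_abs_self M) hx.2.2 (norm_nonneg _) (abs_nonneg _)) (ε := ε / (3 * C)) (by positivity)
  refine ⟨Subtype.val '' F, hF.image _, by rintro _ ⟨x, -, rfl⟩; exact x.2, fun x hx hLx => ?_⟩
  obtain ⟨c, hc⟩ : ∃ c : ℂ, ‖x - c • (1 : A)‖ < D + 1 := by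
    refine exists_lt_of_ciInf_lt ((hD x hx).trans_lt ?_)
    nlinarith
  have hxc : x - c • (1 : A) ∈ X := X.sub_mem hx (X.smul_mem _ hX_one)
  have hsub : ∀ a ∈ X, ∀ b ∈ X, L (a - b) ≤ L a + L b := fun a ha b hb => by
    have h1 := hL_add a ha (-b) (X.neg_mem hb)
    have h2 := hL_smul (-1) b hb
    rw [neg_one_smul] at h2
    rw [h2, ← sub_eq_add_neg] at h1
    simpa using h1
  have hLc : L (x - c • (1 : A)) ≤ 1 := by
    refine (hsub _ hx _ (X.smul_mem _ hX_one)).trans ?_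
    rw [hL_smul _ _ hX_one, hL_one, mul_zero, add_zero]; exact hLx
  obtain ⟨y, hy, hxy⟩ := hcov ⟨_, hxc⟩ ⟨hxc, hLc, hc.le⟩
  refine ⟨y, ⟨y, hy, rfl⟩, c, ?_⟩
  have hyS : (y : A) ∈ S := hFS hy
  set z := x - c • (1 : A) - y with hz
  have hzX : z ∈ X := X.sub_mem hxc y.2
  have h1 : ‖Φ z‖ ≤ ε / (3 * C) := by
    rw [hz, map_sub]; exact hxy
  have h2 : ‖ι z - Φ z‖ ≤ ε / (3 * C) * 2 := by
    refine (happ z hzX).trans ?_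
    gcongr
    exact (hsub _ hxc _ y.2).trans (by linarith [hyS.2.1])
  have h3 : ‖ι z‖ ≤ ε / C := by
    calc ‖ι z‖ = ‖(ι z - Φ z) + Φ z‖ := by rw [sub_add_cancel]
      _ ≤ _ := norm_add_le _ _
      _ ≤ ε / (3 * C) * 2 + ε / (3 * C) := add_le_add h2 h1
      _ = ε / C := by field_simp; norm_num
  have h4 := (hι z hzX).trans h3
  rw [show x - (y : A) - c • (1 : A) = z by rw [hz]; abel]
  rw [one_div, inv_mul_le_iff₀ hC, mul_div_cancel₀ _ hC.ne'] at h4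
  exact h4

lemma norm_map_eq_mul_norm_map_inv_smul {V W : Type*} [AddCommGroup V] [Module ℂ V]
    [NormedAddCommGroup W] [NormedSpace ℂ W] (f : V →ₗ[ℂ] W) {s : ℝ} (hs : 0 < s) (x : V) :
    ‖f x‖ = s * ‖f (((s⁻¹ : ℝ) : ℂ) • x)‖ := by
  rw [map_smul, norm_smul, Complex.norm_real, Real.norm_of_nonneg (by positivity),
    mul_inv_cancel_left₀ hs.ne']

lemma IsCompression.exists_star_mul_self {A : Type*} [CStarAlgebra A] {φ : A →ₗ[ℂ] EndTwo}
    (hφ : IsCompression φ) (y : A) : ∃ w : EndTwo, φ (star y * y) = star w * w ∧ ‖w‖ ≤ ‖y‖ := by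
  obtain ⟨w, hw⟩ := hφ.pos y
  refine ⟨w, hw, ?_⟩
  have h1 := hφ.norm_le (star y * y)
  have h2 : ‖star w * w‖ = ‖w‖ * ‖w‖ := CStarRing.norm_star_mul_self (E := EndTwo)
  rw [hw, h2, CStarRing.norm_star_mul_self] at h1
  exact (mul_self_le_mul_self_iff (norm_nonneg w) (norm_nonneg y)).2 h1

lemma LipschitzBallTotallyBounded.positiveIsometricApprox {A : Type u} [CStarAlgebra A] {X : Submodule ℂ A} {L : A → ℝ}
    (hL_nonneg : ∀ x ∈ X, 0 ≤ L x) (hL_smul : ∀ (c : ℂ), ∀ x ∈ X, L (c • x) = ‖c‖ * L x)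
    (h : LipschitzBallTotallyBounded X L) {ε : ℝ} (hε : 0 < ε) : Nonempty (PositiveIsometricApprox X L ε) := by
  rcases subsingleton_or_nontrivial A with hA | hA
  · exact ⟨{ B := A, Y := ⊤, one_mem_Y := trivial, star_mem_Y := fun _ _ => trivial
             ι := LinearMap.id, Φ := LinearMap.id, mem_Y := fun _ _ => ⟨trivial, trivial⟩
             ι_one := rfl, Φ_one := rfl, Φ_bounded := ⟨1, fun x _ => by simp⟩
             ι_isometric := fun _ _ => rfl, Φ_positive := fun _ _ h => h
             Φ_finite := inferInstance
             approx := fun x hx => by simpa using mul_nonneg hε.le (hL_nonneg x hx) }⟩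
  let K := {φ : A →ₗ[ℂ] EndTwo // IsCompression φ}
  let _ : TopologicalSpace K := ⊥
  have : DiscreteTopology K := ⟨rfl⟩
  obtain ⟨F, hF, -, hcov⟩ := h (ε / 3) (by positivity)
  obtain ⟨M, hM⟩ := hF.isBounded.exists_norm_le
  have := hF.fintype
  obtain ⟨J, hJ, -, hJcov⟩ := exists_finite_net (V := F → EndTwo) (fun φ : K => fun y : F => φ.1 y) Set.univ
    |M| (fun φ _ => (pi_norm_le_iff_of_nonneg (abs_nonneg M)).2 fun y =>
      (φ.2.norm_le y).trans ((hM y y.2).trans (le_abs_self M))) (ε := ε / 3) (by positivity)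
  have := hJ.fintype
  choose j hjJ hj using fun φ => hJcov φ (Set.mem_univ φ)
  let ι : A →ₗ[ℂ] (K →ᵇ EndTwo) :=
    { toFun := fun a => BoundedContinuousFunction.ofNormedAddCommGroupDiscrete (fun φ : K => φ.1 a) ‖a‖ (fun φ => φ.2.norm_le a)
      map_add' := fun a b => by ext1 φ; exact map_add φ.1 a b
      map_smul' := fun c a => by ext1 φ; exact map_smul φ.1 c a }
  let R : (J → EndTwo) →ₗ[ℂ] (K →ᵇ EndTwo) :=
    { toFun := fun u => BoundedContinuousFunction.ofNormedAddCommGroupDiscrete (fun φ : K => u ⟨j φ, hjJ φ⟩) ‖u‖ (fun φ => norm_le_pi_norm u _)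
      map_add' := fun a b => rfl
      map_smul' := fun c a => rfl }
  let G : A →ₗ[ℂ] (J → EndTwo) := LinearMap.pi fun i => i.1.1
  let Φ := R ∘ₗ G
  refine ⟨{ B := K →ᵇ EndTwo, Y := ⊤, one_mem_Y := trivial, star_mem_Y := fun _ _ => trivial
            ι := ι, Φ := Φ, mem_Y := fun _ _ => ⟨trivial, trivial⟩
            ι_one := ?_, Φ_one := ?_, Φ_bounded := ⟨1, fun x _ => ?_⟩
            ι_isometric := fun x _ => ?_, Φ_positive := ?_
            Φ_finite := ?_
            approx := ?_ }⟩
  · ext1 φ; exact φ.2.map_one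
  · ext1 φ; exact (j φ).2.map_one
  · rw [one_mul]
    exact (BoundedContinuousFunction.norm_le (norm_nonneg x)).2 fun φ => (j φ).2.norm_le x
  · refine le_antisymm ((BoundedContinuousFunction.norm_le (norm_nonneg x)).2 fun φ => φ.2.norm_le x) ?_
    obtain ⟨φ, hφ, hx⟩ := exists_compression x
    exact hx.trans ((ι x).norm_coe_le_norm ⟨φ, hφ⟩)
  · rintro _ - ⟨y, rfl⟩
    choose w hw hwn using fun φ : K => φ.2.exists_star_mul_self y
    refine ⟨BoundedContinuousFunction.ofNormedAddCommGroupDiscrete (fun φ : K => w (j φ)) ‖y‖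
      (fun φ => hwn (j φ)), ?_⟩
    ext1 φ; exact hw (j φ)
  · refine Submodule.finiteDimensional_of_le (S₂ := LinearMap.range R) (Submodule.span_le.2 ?_)
    rintro _ ⟨x, -, rfl⟩
    exact ⟨G x, rfl⟩
  · intro x hx
    refine (BoundedContinuousFunction.norm_le (mul_nonneg hε.le (hL_nonneg x hx))).2 fun φ => ?_
    refine le_mul_of_le_of_le_one X L hL_nonneg hL_smul (fun x => ‖φ.1 x - (j φ).1 x‖)
      (fun s hs x => ?_) ε hε.le ?_ x hx
    · exact (norm_map_eq_mul_norm_map_inv_smul (φ.1 - (j φ).1) hs x).le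
    · intro x hx hLx
      obtain ⟨y, hy, c, hc⟩ := hcov x hx hLx
      set r := x - y - c • (1 : A) with hr
      have hx' : x = r + y + c • (1 : A) := by rw [hr]; abel
      have h1 : φ.1 x - (j φ).1 x = φ.1 r - (j φ).1 r + (φ.1 y - (j φ).1 y) := by
        rw [hx']; simp only [map_add, map_smul, φ.2.map_one, (j φ).2.map_one]; abel
      have h2 : ‖φ.1 y - (j φ).1 y‖ ≤ ε / 3 := (norm_le_pi_norm _ (⟨y, hy⟩ : F)).trans (hj φ)
      rw [h1]
      calc _ ≤ ‖φ.1 r‖ + ‖(j φ).1 r‖ + ‖φ.1 y - (j φ).1 y‖ :=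
            (norm_add_le _ _).trans (add_le_add_left (norm_sub_le _ _) _)
        _ ≤ ε / 3 + ε / 3 + ε / 3 := by
            gcongr
            · exact (φ.2.norm_le r).trans hc
            · exact ((j φ).2.norm_le r).trans hc
        _ = ε := by ring

lemma PositiveIsometricApprox.toEpsCApprox {A : Type u} [CStarAlgebra A] {X : Submodule ℂ A} {L : A → ℝ} {ε : ℝ}
   (h : PositiveIsometricApprox X L ε) : Nonempty (EpsCApprox X L ε 1) := by
  obtain ⟨B, Y, h1, h2, ι, Φ, h3, h4, h5, h6, h7, h8, h9, h10⟩ := h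
  exact ⟨⟨B, Y, h1, h2, ι, Φ, h3, h4, h5, ⟨1, fun x hx => by rw [h7 x hx, one_mul]⟩, h6,
    fun x hx => by rw [h7 x hx, one_div_one, one_mul], h9, h10⟩⟩

end

section

variable {A : Type*} [CStarAlgebra A] {X : Submodule ℂ A} {hX_one : (1 : A) ∈ X} {L : A → ℝ}

lemma realPart_coe_eq (x : A) : ((realPart x : A)) = (1 / 2 : ℂ) • (x + star x) := by
  rw [realPart_apply_coe, ← Complex.coe_smul]; norm_num

lemma imaginaryPart_coe_eq (x : A) : ((imaginaryPart x : A)) = (-(Complex.I / 2)) • (x - star x) := by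
  rw [imaginaryPart_apply_coe, ← Complex.coe_smul, smul_smul]; congr 1; push_cast; ring

lemma norm_state_selfAdjoint_le {φ : X → ℂ} (hφ : φ ∈ stateSet X hX_one) (x : X) (hx : IsSelfAdjoint (x : A)) :
    ‖φ x‖ ≤ ‖x‖ := by
  let _ := CStarAlgebra.spectralOrder A
  have := CStarAlgebra.spectralOrderedRing A
  obtain ⟨hadd, hsmul, h1, hpos⟩ := hφ
  have hp : 0 ≤ φ ((‖x‖ : ℂ) • ⟨1, hX_one⟩ + (1 : ℂ) • x) := by
    refine hpos _ (CStarAlgebra.nonneg_iff_eq_star_mul_self.1 ?_)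
    have := hx.neg_algebraMap_norm_le_self
    rw [Algebra.algebraMap_eq_smul_one, neg_le_iff_add_nonneg', ← Complex.coe_smul] at this
    simpa using this
  have hm : 0 ≤ φ ((‖x‖ : ℂ) • ⟨1, hX_one⟩ + (-1 : ℂ) • x) := by
    refine hpos _ (CStarAlgebra.nonneg_iff_eq_star_mul_self.1 ?_)
    have := hx.le_algebraMap_norm_self
    rw [Algebra.algebraMap_eq_smul_one, ← sub_nonneg, ← Complex.coe_smul] at this
    simpa [sub_eq_add_neg] using this
  rw [hadd, hsmul, hsmul, h1, Complex.nonneg_iff] at hp hm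
  simp at hp hm
  have him : (φ x).im = 0 := hp.2.symm
  have : φ x = ((φ x).re : ℂ) := by apply Complex.ext <;> simp [him]
  rw [this, Complex.norm_real, Real.norm_eq_abs, abs_le]
  constructor <;> simp <;> linarith [hp.1, hm.1]

lemma norm_state_le (hX_star : ∀ x ∈ X, star x ∈ X) {φ : X → ℂ} (hφ : φ ∈ stateSet X hX_one) (x : X) :
    ‖φ x‖ ≤ 2 * ‖x‖ := by
  have hr : (realPart (x : A) : A) ∈ X := by
    rw [realPart_coe_eq]; exact X.smul_mem _ (X.add_mem x.2 (hX_star _ x.2))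
  have hi : (imaginaryPart (x : A) : A) ∈ X := by
    rw [imaginaryPart_coe_eq]; exact X.smul_mem _ (X.sub_mem x.2 (hX_star _ x.2))
  have hx : x = ⟨_, hr⟩ + Complex.I • ⟨_, hi⟩ := Subtype.ext (realPart_add_I_smul_imaginaryPart (x : A)).symm
  have h1 := norm_state_selfAdjoint_le hφ ⟨_, hr⟩ (realPart (x : A)).2
  have h2 := norm_state_selfAdjoint_le hφ ⟨_, hi⟩ (imaginaryPart (x : A)).2
  have h3 : ‖(realPart (x : A) : A)‖ ≤ ‖x‖ := realPart.norm_le (x : A)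
  have h4 : ‖(imaginaryPart (x : A) : A)‖ ≤ ‖x‖ := imaginaryPart.norm_le (x : A)
  have h5 : φ x = φ ⟨_, hr⟩ + Complex.I * φ ⟨_, hi⟩ := by
    rw [← hφ.2.1, ← hφ.1]; exact congrArg φ hx
  rw [h5]
  refine (norm_add_le _ _).trans ?_
  rw [norm_mul, Complex.norm_I, one_mul]
  exact (add_le_add (h1.trans h3) (h2.trans h4)).trans_eq (two_mul _).symm

lemma restrict_mem_stateSet [PartialOrder A] [StarOrderedRing A] (f : A →ₚ[ℂ] ℂ) (h1 : f 1 = 1) :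
    (fun x : X => f x) ∈ stateSet X hX_one := by
  refine ⟨fun x y => map_add f (x : A) y, fun c x => map_smul f c (x : A), h1, ?_⟩
  rintro x ⟨y, hy⟩
  exact f.map_nonneg (CStarAlgebra.nonneg_iff_eq_star_mul_self.2 ⟨y, hy⟩)

lemma stateSet_nonempty [Nontrivial A] : (stateSet X hX_one).Nonempty := by
  let _ := CStarAlgebra.spectralOrder A
  have := CStarAlgebra.spectralOrderedRing A
  obtain ⟨f, h1, -⟩ := exists_state (1 : A) (IsSelfAdjoint.one A)
  exact ⟨_, restrict_mem_stateSet f h1⟩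

lemma norm_le_of_forall_state [Nontrivial A] (x : X) (M : ℝ)
    (h : ∀ φ ∈ stateSet X hX_one, ‖φ x‖ ≤ M) : ‖x‖ ≤ 2 * M := by
  let _ := CStarAlgebra.spectralOrder A
  have := CStarAlgebra.spectralOrderedRing A
  have hf : ∀ f : A →ₚ[ℂ] ℂ, f 1 = 1 → ‖f x‖ ≤ M ∧ ‖f (star (x : A))‖ ≤ M := fun f h1 => by
    have := h _ (restrict_mem_stateSet f h1)
    refine ⟨this, ?_⟩
    rw [map_star, norm_star]; exact this
  have hr : ‖(realPart (x : A) : A)‖ ≤ M := by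
    obtain ⟨f, h1, h2⟩ := exists_state _ (realPart (x : A)).2
    rw [← h2, realPart_coe_eq, map_smul, map_add, norm_smul]
    have := norm_add_le (f (x : A)) (f (star (x : A)))
    norm_num
    linarith [(hf f h1).1, (hf f h1).2]
  have hi : ‖(imaginaryPart (x : A) : A)‖ ≤ M := by
    obtain ⟨f, h1, h2⟩ := exists_state _ (imaginaryPart (x : A)).2
    rw [← h2, imaginaryPart_coe_eq, map_smul, map_sub, norm_smul]
    have := norm_sub_le (f (x : A)) (f (star (x : A)))
    norm_num
    linarith [(hf f h1).1, (hf f h1).2]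
  change ‖(x : A)‖ ≤ _
  rw [← realPart_add_I_smul_imaginaryPart (x : A)]
  refine (norm_add_le _ _).trans ?_
  rw [norm_smul, Complex.norm_I, one_mul]
  linarith

lemma mkDist_le_iff {φ ψ : X → ℂ} {r : ℝ≥0∞} :
    mkDist X L φ ψ ≤ r ↔ ∀ x : X, L x ≤ 1 → (‖φ x - ψ x‖₊ : ℝ≥0∞) ≤ r := by
  simp [mkDist, iSup_le_iff]

lemma mkDist_le_ofReal_iff {φ ψ : X → ℂ} {r : ℝ} (hr : 0 ≤ r) :
    mkDist X L φ ψ ≤ ENNReal.ofReal r ↔ ∀ x : X, L x ≤ 1 → ‖φ x - ψ x‖ ≤ r := by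
  rw [mkDist_le_iff]
  refine forall₂_congr fun x _ => ?_
  rw [ENNReal.ofReal, ENNReal.coe_le_coe, ← NNReal.coe_le_coe, coe_nnnorm, Real.coe_toNNReal _ hr]

lemma mkDist_self (φ : X → ℂ) : mkDist X L φ φ = 0 := by
  simp [mkDist]

lemma mkDist_comm (φ ψ : X → ℂ) : mkDist X L φ ψ = mkDist X L ψ φ := by
  simp only [mkDist]
  exact iSup_congr fun x => by rw [← nnnorm_neg, neg_sub]

lemma mkDist_triangle (φ ψ χ : X → ℂ) : mkDist X L φ χ ≤ mkDist X L φ ψ + mkDist X L ψ χ := by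
  refine mkDist_le_iff.2 fun x hx => ?_
  have h : ‖φ x - χ x‖₊ ≤ ‖φ x - ψ x‖₊ + ‖ψ x - χ x‖₊ := by
    simpa using nnnorm_add_le (φ x - ψ x) (ψ x - χ x)
  exact (ENNReal.coe_le_coe.2 h).trans (by
    rw [ENNReal.coe_add]
    exact add_le_add (mkDist_le_iff.1 le_rfl x hx) (mkDist_le_iff.1 le_rfl x hx))

lemma continuous_eval (x : X) : Continuous fun φ : stateSet X hX_one => (φ : X → ℂ) x :=
  (continuous_apply x).comp continuous_subtype_val

lemma compactSpace_stateSet (hX_star : ∀ x ∈ X, star x ∈ X) : CompactSpace (stateSet X hX_one) := by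
  rw [← isCompact_iff_compactSpace]
  refine (isCompact_univ_pi fun x : X => isCompact_closedBall (0 : ℂ) (2 * ‖x‖)).of_isClosed_subset ?_ ?_
  · simp only [stateSet, Set.ofPred_and, Set.ofPred_forall]
    refine IsClosed.inter ?_ (IsClosed.inter ?_ (IsClosed.inter ?_ ?_))
    · refine isClosed_iInter fun x => isClosed_iInter fun y => isClosed_eq ?_ ?_ <;> fun_prop
    · refine isClosed_iInter fun c => isClosed_iInter fun x => isClosed_eq ?_ ?_ <;> fun_prop
    · exact isClosed_eq (continuous_apply _) continuous_const
    · exact isClosed_iInter fun x => isClosed_iInter fun _ =>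
        isClosed_le continuous_const (continuous_apply x)
  · intro φ hφ x _
    simpa using norm_state_le hX_star hφ x

lemma norm_state_sub_le (hX_star : ∀ x ∈ X, star x ∈ X) (φ ψ : stateSet X hX_one) (x y : X) (c : ℂ) :
    ‖(φ : X → ℂ) x - (ψ : X → ℂ) x‖ ≤
      4 * ‖(x : A) - y - c • (1 : A)‖ + ‖(φ : X → ℂ) y - (ψ : X → ℂ) y‖ := by
  obtain ⟨r, hr⟩ : ∃ r : X, r = x - y - c • ⟨1, hX_one⟩ := ⟨_, rfl⟩
  have hx : x = r + y + c • ⟨1, hX_one⟩ := by rw [hr]; abel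
  have hn : ‖r‖ = ‖(x : A) - y - c • (1 : A)‖ := by rw [hr]; rfl
  have key : ∀ χ : stateSet X hX_one, (χ : X → ℂ) x = (χ : X → ℂ) r + (χ : X → ℂ) y + c :=
    fun χ => by
      conv_lhs => rw [hx]
      rw [χ.2.1, χ.2.1, χ.2.2.1, χ.2.2.2.1, mul_one]
  have e : (φ : X → ℂ) x - (ψ : X → ℂ) x =
      ((φ : X → ℂ) r - (ψ : X → ℂ) r) + ((φ : X → ℂ) y - (ψ : X → ℂ) y) := by
    rw [key, key]; ring
  rw [e, ← hn]
  have h1 := norm_state_le hX_star φ.2 r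
  have h2 := norm_state_le hX_star ψ.2 r
  have h3 := norm_sub_le ((φ : X → ℂ) r) ((ψ : X → ℂ) r)
  refine (norm_add_le _ _).trans ?_
  linarith

lemma LipschitzBallTotallyBounded.isOpen_ball (hX_star : ∀ x ∈ X, star x ∈ X)
    (h : LipschitzBallTotallyBounded X L) (φ : stateSet X hX_one) (r : ℝ≥0∞) :
    IsOpen {ψ : stateSet X hX_one | mkDist X L (φ : X → ℂ) (ψ : X → ℂ) < r} := by
  rw [isOpen_iff_mem_nhds]
  intro ψ hψ
  obtain ⟨δ, hδ, hlt⟩ := ENNReal.lt_iff_exists_add_pos_lt.1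
    (show mkDist X L (φ : X → ℂ) ψ < r from hψ)
  obtain ⟨η, hη⟩ : ∃ η : ℝ, η = δ := ⟨_, rfl⟩
  have hη0 : 0 < η := hη ▸ NNReal.coe_pos.2 hδ
  obtain ⟨F, hF, hFX, hcov⟩ := h (η / 5) (by positivity)
  have hev : ∀ᶠ χ : stateSet X hX_one in nhds ψ, ∀ y ∈ ((↑) ⁻¹' F : Set X),
      ‖(ψ : X → ℂ) y - (χ : X → ℂ) y‖ < η / 5 := by
    refine (hF.preimage Subtype.val_injective.injOn).eventually_all.2 fun y _ => ?_
    have hc : Continuous fun χ : stateSet X hX_one => ‖(ψ : X → ℂ) y - (χ : X → ℂ) y‖ :=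
      (continuous_const.sub (continuous_eval y)).norm
    refine hc.continuousAt.eventually_lt_const ?_
    simpa using hη0
  filter_upwards [hev] with χ hχ
  have hle : mkDist X L (ψ : X → ℂ) χ ≤ δ := by
    rw [← ENNReal.ofReal_coe_nnreal, ← hη, mkDist_le_ofReal_iff hη0.le]
    intro x hx
    obtain ⟨y, hy, c, hc⟩ := hcov x x.2 hx
    have h1 := norm_state_sub_le hX_star ψ χ x ⟨y, hFX hy⟩ c
    have h2 := hχ ⟨y, hFX hy⟩ hy
    linarith
  calc mkDist X L (φ : X → ℂ) χ ≤ mkDist X L φ ψ + mkDist X L ψ χ := mkDist_triangle _ _ _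
    _ ≤ mkDist X L φ ψ + δ := by gcongr
    _ < r := hlt

lemma norm_sub_le_of_mkDist_le (hL_nonneg : ∀ x ∈ X, 0 ≤ L x) (hL_smul : ∀ (c : ℂ), ∀ x ∈ X, L (c • x) = ‖c‖ * L x)
    (φ ψ : stateSet X hX_one) {r : ℝ} (hr : 0 ≤ r) (h : mkDist X L (φ : X → ℂ) ψ ≤ ENNReal.ofReal r) (x : X) :
    ‖(φ : X → ℂ) x - (ψ : X → ℂ) x‖ ≤ r * (L x + 1) := by
  have hs : 0 < L x + 1 := by linarith [hL_nonneg x x.2]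
  have h1 := (mkDist_le_ofReal_iff hr).1 h ((((L x + 1)⁻¹ : ℝ) : ℂ) • x) (by
    change L ((((L x + 1)⁻¹ : ℝ) : ℂ) • (x : A)) ≤ 1
    rw [hL_smul _ _ x.2, Complex.norm_real, Real.norm_of_nonneg (by positivity), inv_mul_le_iff₀ hs]
    linarith)
  rw [φ.2.2.1, ψ.2.2.1, ← mul_sub, norm_mul, Complex.norm_real, Real.norm_of_nonneg (by positivity),
    inv_mul_le_iff₀ hs] at h1
  linarith

lemma LipschitzBallTotallyBounded.isCQMS (hX_star : ∀ x ∈ X, star x ∈ X) (hL_nonneg : ∀ x ∈ X, 0 ≤ L x)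
    (hL_smul : ∀ (c : ℂ), ∀ x ∈ X, L (c • x) = ‖c‖ * L x) (h : LipschitzBallTotallyBounded X L) :
    IsCQMS X hX_one L := by
  refine le_antisymm ?_ (le_generateFrom ?_)
  · refine continuous_iff_le_induced.1 (@continuous_pi _ _ _ (mkBallTopology X hX_one L) _ _ fun x => ?_)
    refine @continuous_iff_continuousAt _ _ (mkBallTopology X hX_one L) _ _ |>.2 fun φ => ?_
    refine Metric.tendsto_nhds.2 fun ε hε => ?_
    have hs : 0 < L x + 1 := by linarith [hL_nonneg x x.2]
    have hpos : 0 < ε / (L x + 1) / 2 := by positivity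
    have hopen : @IsOpen _ (mkBallTopology X hX_one L)
        {ψ : stateSet X hX_one | mkDist X L (φ : X → ℂ) ψ < ENNReal.ofReal (ε / (L x + 1) / 2)} :=
      TopologicalSpace.isOpen_generateFrom_of_mem ⟨φ, _, ENNReal.ofReal_ne_top, rfl⟩
    have hmem := @IsOpen.mem_nhds _ (mkBallTopology X hX_one L) φ _ hopen (by
      change mkDist X L (φ : X → ℂ) φ < _
      rw [mkDist_self]; exact ENNReal.ofReal_pos.2 hpos)
    refine Filter.mem_of_superset hmem fun ψ hψ => ?_
    have := norm_sub_le_of_mkDist_le hL_nonneg hL_smul φ ψ hpos.le (le_of_lt hψ) x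
    change dist ((ψ : X → ℂ) x) ((φ : X → ℂ) x) < ε
    rw [dist_comm, dist_eq_norm]
    refine this.trans_lt ?_
    have : ε / (L x + 1) / 2 * (L x + 1) = ε / 2 := by field_simp
    linarith
  · rintro _ ⟨φ, r, -, rfl⟩
    exact h.isOpen_ball hX_star φ r

lemma IsCQMS.isOpen_ball (h : IsCQMS X hX_one L) (φ : stateSet X hX_one) {r : ℝ≥0∞} (hr : r ≠ ⊤) :
    IsOpen {ψ : stateSet X hX_one | mkDist X L (φ : X → ℂ) (ψ : X → ℂ) < r} := by
  have : @IsOpen _ (mkBallTopology X hX_one L) {ψ : stateSet X hX_one | mkDist X L (φ : X → ℂ) (ψ : X → ℂ) < r} :=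
    TopologicalSpace.isOpen_generateFrom_of_mem ⟨φ, r, hr, rfl⟩
  unfold IsCQMS at h
  rwa [h] at this

/-- The segment joining two states. -/
noncomputable def stateSegment (φ ψ : stateSet X hX_one) (t : Set.Icc (0 : ℝ) 1) : stateSet X hX_one :=
  ⟨fun x => (1 - (t : ℝ) : ℂ) * (φ : X → ℂ) x + (t : ℝ) * (ψ : X → ℂ) x, by
    refine ⟨fun x y => ?_, fun c x => ?_, ?_, fun x hx => ?_⟩
    · simp only [φ.2.1, ψ.2.1]; ring
    · simp only [φ.2.2.1, ψ.2.2.1]; ring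
    · simp only [φ.2.2.2.1, ψ.2.2.2.1]; ring
    · have h1 : (0 : ℂ) ≤ 1 - (t : ℝ) := by
        rw [← Complex.ofReal_one, ← Complex.ofReal_sub]; exact Complex.zero_le_real.2 (by linarith [t.2.2])
      have h2 : (0 : ℂ) ≤ (t : ℝ) := Complex.zero_le_real.2 t.2.1
      exact add_nonneg (mul_nonneg h1 (φ.2.2.2.2 x hx)) (mul_nonneg h2 (ψ.2.2.2.2 x hx))⟩

lemma IsCQMS.mkDist_ne_top (h : IsCQMS X hX_one L) (φ ψ : stateSet X hX_one) : mkDist X L (φ : X → ℂ) ψ ≠ ⊤ := by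
  have hc : Continuous (stateSegment φ ψ) := by
    refine Continuous.subtype_mk (continuous_pi fun x => ?_) _
    fun_prop
  let z : Set.Icc (0 : ℝ) 1 := ⟨0, by simp⟩
  have hz : stateSegment φ ψ z = φ := by
    apply Subtype.ext; funext x; simp [stateSegment, z]
  have hev : ∀ᶠ t in nhds z, mkDist X L (φ : X → ℂ) (stateSegment φ ψ t) < 1 := by
    refine hc.continuousAt.eventually (IsOpen.mem_nhds (h.isOpen_ball φ ENNReal.one_ne_top) ?_)
    change mkDist X L (φ : X → ℂ) (stateSegment φ ψ z) < 1
    rw [hz, mkDist_self]; exact one_pos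
  obtain ⟨ε, hε, hball⟩ := Metric.eventually_nhds_iff.1 hev
  let t : ℝ := min (ε / 2) 1
  have ht0 : 0 < t := lt_min (by positivity) one_pos
  have ht := hball (y := ⟨t, ht0.le, min_le_right _ _⟩) (by
    change dist t 0 < ε
    rw [Real.dist_0_eq_abs, abs_of_pos ht0]
    exact (min_le_left _ _).trans_lt (by linarith))
  rw [← ENNReal.ofReal_one] at ht
  have h1 := (mkDist_le_ofReal_iff zero_le_one).1 ht.le
  refine ne_top_of_le_ne_top (ENNReal.ofReal_ne_top (r := t⁻¹)) ((mkDist_le_ofReal_iff (by positivity)).2 fun x hx => ?_)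
  have h2 := h1 x hx
  have e : (φ : X → ℂ) x - (stateSegment φ ψ ⟨t, ht0.le, min_le_right _ _⟩ : X → ℂ) x = (t : ℂ) * ((φ : X → ℂ) x - (ψ : X → ℂ) x) := by
    simp only [stateSegment]; ring
  rw [e, norm_mul, Complex.norm_real, Real.norm_of_nonneg ht0.le] at h2
  rw [← one_div, le_div_iff₀ ht0]; linarith

lemma IsCQMS.exists_net (hX_star : ∀ x ∈ X, star x ∈ X) (h : IsCQMS X hX_one L) {ε : ℝ} (hε : 0 < ε) :
    ∃ J : Finset (stateSet X hX_one), ∀ ψ : stateSet X hX_one, ∃ j ∈ J, mkDist X L (j : X → ℂ) ψ ≤ ENNReal.ofReal ε := by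
  have := compactSpace_stateSet (hX_one := hX_one) hX_star
  obtain ⟨J, hJ⟩ := isCompact_univ.elim_finite_subcover
    (fun φ : stateSet X hX_one => {ψ : stateSet X hX_one | mkDist X L (φ : X → ℂ) (ψ : X → ℂ) < ENNReal.ofReal ε})
    (fun φ => h.isOpen_ball φ ENNReal.ofReal_ne_top) (fun ψ _ => Set.mem_iUnion.2 ⟨ψ, by
      change mkDist X L (ψ : X → ℂ) ψ < _
      rw [mkDist_self]; exact ENNReal.ofReal_pos.2 hε⟩)
  refine ⟨J, fun ψ => ?_⟩
  obtain ⟨j, hj, hψ⟩ := Set.mem_iUnion₂.1 (hJ (Set.mem_univ ψ))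
  exact ⟨j, hj, le_of_lt hψ⟩

lemma IsCQMS.lipschitzBallTotallyBounded (hX_star : ∀ x ∈ X, star x ∈ X) (h : IsCQMS X hX_one L) :
    LipschitzBallTotallyBounded X L := by
  intro ε hε
  rcases subsingleton_or_nontrivial A with hA | hA
  · refine ⟨{0}, Set.finite_singleton _, by simp, fun x _ _ => ⟨0, rfl, 0, ?_⟩⟩
    rw [Subsingleton.elim (x - 0 - (0 : ℂ) • (1 : A)) 0, norm_zero]; exact hε.le
  obtain ⟨φ, hφ⟩ := stateSet_nonempty (X := X) (hX_one := hX_one)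
  obtain ⟨J, hJ⟩ := h.exists_net hX_star (ε := ε / 6) (by positivity)
  obtain ⟨F, hF, hFS, hcov⟩ := exists_finite_net (fun (x : X) (j : J) => (j.1 : X → ℂ) x - φ x) {x | L x ≤ 1}
    (∑ j ∈ J, (mkDist X L φ (j : X → ℂ)).toReal) (fun x hx => by
      refine (pi_norm_le_iff_of_nonneg (Finset.sum_nonneg fun _ _ => ENNReal.toReal_nonneg)).2 fun j => ?_
      refine le_trans ?_ (Finset.single_le_sum (f := fun j : stateSet X hX_one => (mkDist X L φ (j : X → ℂ)).toReal)
        (fun _ _ => ENNReal.toReal_nonneg) j.2)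
      rw [norm_sub_rev]
      refine (mkDist_le_ofReal_iff ENNReal.toReal_nonneg).1 ?_ x hx
      rw [ENNReal.ofReal_toReal (h.mkDist_ne_top ⟨φ, hφ⟩ j.1)]) (ε := ε / 6) (by positivity)
  refine ⟨Subtype.val '' F, hF.image _, by rintro _ ⟨x, -, rfl⟩; exact x.2, fun x hx hLx => ?_⟩
  obtain ⟨y, hy, hxy⟩ := hcov ⟨x, hx⟩ hLx
  have hLy : L y ≤ 1 := hFS hy
  refine ⟨y, ⟨y, hy, rfl⟩, φ ⟨x, hx⟩ - φ y, ?_⟩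
  let x' : X := ⟨x, hx⟩
  let c := φ x' - φ y
  let z : X := x' + (-1 : ℂ) • y + (-c) • ⟨1, hX_one⟩
  have hz : x - y - c • (1 : A) = z := by
    simp [z, x', sub_eq_add_neg]
  have key : ∀ χ : stateSet X hX_one, (χ : X → ℂ) z = (χ : X → ℂ) x' - (χ : X → ℂ) y - c := fun χ => by
    simp only [z]
    rw [χ.2.1, χ.2.1, χ.2.2.1, χ.2.2.1, χ.2.2.2.1]; ring
  change ‖x - y - c • (1 : A)‖ ≤ ε
  rw [hz]
  refine (norm_le_of_forall_state (hX_one := hX_one) z (ε / 2) fun ψ hψ => ?_).trans_eq (by ring)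
  obtain ⟨j, hj, hjψ⟩ := hJ ⟨ψ, hψ⟩
  have h1 := (mkDist_le_ofReal_iff (by positivity)).1 hjψ x' hLx
  have h2 := (mkDist_le_ofReal_iff (by positivity)).1 hjψ y hLy
  have h3 := (norm_le_pi_norm _ (⟨j, hj⟩ : J)).trans hxy
  change ‖((j : X → ℂ) x' - φ x') - ((j : X → ℂ) y - φ y)‖ ≤ ε / 6 at h3
  have e : ψ z = ((j : X → ℂ) x' - φ x') - ((j : X → ℂ) y - φ y) - ((j : X → ℂ) x' - ψ x') + ((j : X → ℂ) y - ψ y) := by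
    rw [show ψ z = _ from key ⟨ψ, hψ⟩]; simp only [c]; ring
  rw [e]
  refine (norm_add_le _ _).trans ?_
  have h4 := norm_sub_le (((j : X → ℂ) x' - φ x') - ((j : X → ℂ) y - φ y)) ((j : X → ℂ) x' - ψ x')
  change _ + ‖(j : X → ℂ) y - ψ y‖ ≤ _
  change ‖(j : X → ℂ) x' - ψ x'‖ ≤ _ at h1
  change ‖(j : X → ℂ) y - ψ y‖ ≤ _ at h2
  linarith
end

/-- Let `𝒳 ⊆ A` be an operator system and `L : 𝒳 → [0,∞)` a Lipschitz
seminorm.  The following are equivalent: (1) `(𝒳,L)` is a compact quantum metric space;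
(2) `(𝒳,L)` has finite diameter and for every `ε > 0` there exists a positive isometric
`ε`-approximation of `(𝒳,L)`; (3) `(𝒳,L)` has finite diameter and there is a constant `C > 0`
such that for every `ε > 0` there exists an `(ε,C)`-approximation of `(𝒳,L)`. -/
theorem isCQMS_iff_finite_dimensional_approximation {A : Type u} [CStarAlgebra A]
    (X : Submodule ℂ A) (hX_one : (1 : A) ∈ X) (hX_star : ∀ x ∈ X, star x ∈ X)
    (L : A → ℝ)
    (hL_nonneg : ∀ x ∈ X, 0 ≤ L x)
    (hL_add : ∀ x ∈ X, ∀ y ∈ X, L (x + y) ≤ L x + L y)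
    (hL_smul : ∀ (c : ℂ), ∀ x ∈ X, L (c • x) = ‖c‖ * L x)
    (hL_star : ∀ x ∈ X, L (star x) = L x)
    (hL_one : L (1 : A) = 0) :
    (IsCQMS X hX_one L ↔
      (HasFiniteDiameter X L ∧
        ∀ ε : ℝ, 0 < ε → Nonempty (PositiveIsometricApprox X L ε))) ∧
    (IsCQMS X hX_one L ↔
      (HasFiniteDiameter X L ∧
        ∃ C : ℝ, 0 < C ∧ ∀ ε : ℝ, 0 < ε → Nonempty (EpsCApprox X L ε C))) := by
  have h3 : (HasFiniteDiameter X L ∧ ∃ C : ℝ, 0 < C ∧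
      ∀ ε : ℝ, 0 < ε → Nonempty (EpsCApprox X L ε C)) → IsCQMS X hX_one L :=
    fun ⟨hD, C, hC, h⟩ =>
      (lipschitzBallTotallyBounded_of_approx hX_one hL_add hL_smul hL_one hD hC h).isCQMS
        hX_star hL_nonneg hL_smul
  have h12 : IsCQMS X hX_one L → HasFiniteDiameter X L ∧
      ∀ ε : ℝ, 0 < ε → Nonempty (PositiveIsometricApprox X L ε) := fun h =>
    have hT := h.lipschitzBallTotallyBounded hX_star
    ⟨hT.hasFiniteDiameter hL_nonneg hL_smul,
      fun _ hε => hT.positiveIsometricApprox hL_nonneg hL_smul hε⟩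
  have h23 : (HasFiniteDiameter X L ∧
      ∀ ε : ℝ, 0 < ε → Nonempty (PositiveIsometricApprox X L ε)) →
      HasFiniteDiameter X L ∧ ∃ C : ℝ, 0 < C ∧
        ∀ ε : ℝ, 0 < ε → Nonempty (EpsCApprox X L ε C) := fun ⟨hD, h⟩ =>
    ⟨hD, 1, one_pos, fun ε hε => (h ε hε).elim fun P => P.toEpsCApprox⟩
  exact ⟨⟨h12, fun h => h3 (h23 h)⟩, ⟨fun h => h23 (h12 h), h3⟩⟩
end

section
/- Let (M,ρ) be a compact metric space and let B be a finite-dimensional unital C*-algebra. For every ε > 0 there exist finitely many points p_1, …, p_k ∈ M and Lipschitz functions φ_1, …, φ_k : M → [0,1] with Σ_{j=1}^k φ_j = 1 such that the unital positive linear map Φ : Lip(M,B) → Lip(M,B) defined by Φ(f) := Σ_{j=1}^k f(p_j)·φ_j has finite-dimensional image and satisfies sup_{p∈M} ‖f(p) − Φ(f)(p)‖ ≤ ε·L_ρ(f) for every Lipschitz map f : M → B. -/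
/-- The Lipschitz constant `L_ρ(f)` of a map `f : M → B`, defined as the infimum of the
nonnegative constants `K` with `‖f(p) − f(q)‖ ≤ K·ρ(p,q)` for all `p, q`.  For a Lipschitz map
this agrees with `sup{‖f(p) − f(q)‖/ρ(p,q) : p ≠ q}` (and it is `0` when `M` is a single
point). -/
noncomputable def lipConst {M B : Type*} [MetricSpace M] [SeminormedAddCommGroup B]
    (f : M → B) : ℝ :=
  sInf {K : ℝ | 0 ≤ K ∧ ∀ p q : M, ‖f p - f q‖ ≤ K * dist p q}

lemma lipConst_nonneg {M B : Type*} [MetricSpace M] [SeminormedAddCommGroup B] (f : M → B) :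
    0 ≤ lipConst f :=
  Real.sInf_nonneg fun _ hK => hK.1

lemma norm_sub_le_lipConst_mul_dist {M B : Type*} [MetricSpace M] [SeminormedAddCommGroup B]
    {f : M → B} (hf : ∃ K : ℝ, 0 ≤ K ∧ ∀ x y : M, ‖f x - f y‖ ≤ K * dist x y) (x y : M) :
    ‖f x - f y‖ ≤ lipConst f * dist x y := by
  rcases eq_or_ne x y with rfl | hxy
  · simp
  · have hd : 0 < dist x y := dist_pos.2 hxy
    rw [← div_le_iff₀ hd]
    exact le_csInf hf fun K hK => (div_le_iff₀ hd).2 (hK.2 x y)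

lemma exists_fin_forall_dist_lt {M : Type*} [MetricSpace M] [CompactSpace M]
    {ε : ℝ} (hε : 0 < ε) : ∃ (k : ℕ) (p : Fin k → M), ∀ x, ∃ j, dist x (p j) < ε := by
  obtain ⟨t, ht, hcover⟩ :=
    Metric.totallyBounded_iff.1 (isCompact_univ (X := M)).totallyBounded ε hε
  have := ht.to_subtype
  obtain ⟨k, ⟨e⟩⟩ := Finite.exists_equiv_fin t
  refine ⟨k, fun j => e.symm j, fun x => ?_⟩
  obtain ⟨y, hy, hxy⟩ := Set.mem_iUnion₂.1 (hcover (Set.mem_univ x))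
  exact ⟨e ⟨y, hy⟩, by simpa using hxy⟩

/-- A compact metric space carries a finite Lipschitz partition of unity whose members
are supported in balls of radius `ε`. -/
lemma exists_lipschitz_partition_of_unity {M : Type*} [MetricSpace M] [CompactSpace M]
    {ε : ℝ} (hε : 0 < ε) :
    ∃ (k : ℕ) (p : Fin k → M) (φ : Fin k → M → ℝ),
      (∀ j, ∃ K : ℝ, 0 ≤ K ∧ ∀ x y : M, |φ j x - φ j y| ≤ K * dist x y) ∧
      (∀ j x, φ j x ∈ Set.Icc (0 : ℝ) 1) ∧
      (∀ x : M, ∑ j, φ j x = 1) ∧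
      (∀ j x, φ j x ≠ 0 → dist x (p j) ≤ ε) := by
  obtain ⟨k, p, hp⟩ := exists_fin_forall_dist_lt (M := M) (half_pos hε)
  set ψ : Fin k → M → ℝ := fun j x => max (ε - dist x (p j)) 0
  set S : M → ℝ := fun x => ∑ j, ψ j x
  have hψ0 (j x) : 0 ≤ ψ j x := le_max_right _ _
  have hψS (j x) : ψ j x ≤ S x :=
    Finset.single_le_sum (f := fun j => ψ j x) (fun i _ => hψ0 i x) (Finset.mem_univ j)
  have hS (x) : ε / 2 ≤ S x := by
    obtain ⟨j, hj⟩ := hp x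
    have : ε - dist x (p j) ≤ ψ j x := le_max_left _ _
    linarith [hψS j x]
  have hS0 (x) : 0 < S x := (half_pos hε).trans_le (hS x)
  have hψL (j x y) : |ψ j x - ψ j y| ≤ dist x y := by
    refine (abs_max_sub_max_le_abs _ _ _).trans ?_
    rw [sub_sub_sub_cancel_left, abs_sub_comm]
    exact abs_dist_sub_le x y (p j)
  have hSL (x y) : |S x - S y| ≤ k * dist x y := by
    rw [← Finset.sum_sub_distrib]
    refine (Finset.abs_sum_le_sum_abs _ _).trans ?_
    simpa using Finset.sum_le_sum fun j (_ : j ∈ Finset.univ) => hψL j x y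
  have hφ1 (j x) : ψ j x / S x ≤ 1 := (div_le_one (hS0 x)).2 (hψS j x)
  have hφ0 (j x) : 0 ≤ ψ j x / S x := div_nonneg (hψ0 j x) (hS0 x).le
  refine ⟨k, p, fun j x => ψ j x / S x, fun j => ⟨(1 + k) / (ε / 2), by positivity, fun x y => ?_⟩,
    fun j x => ⟨hφ0 j x, hφ1 j x⟩, fun x => ?_, fun j x h => ?_⟩
  · have hx := hS0 x
    have hy := hS0 y
    have key : ψ j x / S x - ψ j y / S y
        = ((ψ j x - ψ j y) - ψ j y / S y * (S x - S y)) / S x := by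
      field_simp
      ring
    have hnum : |(ψ j x - ψ j y) - ψ j y / S y * (S x - S y)| ≤ (1 + k) * dist x y := by
      refine (abs_sub _ _).trans ?_
      rw [abs_mul, abs_of_nonneg (hφ0 j y), add_mul, one_mul]
      exact add_le_add (hψL j x y)
        ((mul_le_of_le_one_left (abs_nonneg _) (hφ1 j y)).trans (hSL x y))
    rw [key, abs_div, abs_of_pos hx, div_mul_eq_mul_div ((1 : ℝ) + k)]
    exact div_le_div₀ (by positivity) hnum (half_pos hε) (hS x)
  · rw [← Finset.sum_div, div_self (hS0 x).ne']
  · by_contra! hd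
    exact h (by simp [ψ, max_eq_right (sub_nonpos.2 hd.le)])

/-- Let `(M,ρ)` be a compact metric space and let `B` be a finite-dimensional
unital C*-algebra.  For every `ε > 0` there exist finitely many points `p_1, …, p_k ∈ M` and
Lipschitz functions `φ_1, …, φ_k : M → [0,1]` with `Σ_j φ_j = 1` such that the unital positive
linear map `Φ : Lip(M,B) → Lip(M,B)` defined by `Φ(f) := Σ_j f(p_j)·φ_j` has finite-dimensional
image and satisfies `sup_p ‖f(p) − Φ(f)(p)‖ ≤ ε·L_ρ(f)` for every Lipschitz map `f : M → B`. -/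
theorem finite_dimensional_approximation_of_lipschitz_functions
    {M : Type*} [MetricSpace M] [CompactSpace M]
    {B : Type*} [CStarAlgebra B] [FiniteDimensional ℂ B]
    (ε : ℝ) (hε : 0 < ε) :
    ∃ (k : ℕ) (p : Fin k → M) (φ : Fin k → M → ℝ),
      (∀ j, ∃ K : ℝ, 0 ≤ K ∧ ∀ x y : M, |φ j x - φ j y| ≤ K * dist x y) ∧
      (∀ j x, φ j x ∈ Set.Icc (0 : ℝ) 1) ∧
      (∀ x : M, ∑ j, φ j x = 1) ∧
      FiniteDimensional ℂ (Submodule.span ℂ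
        {g : M → B | ∃ f : M → B,
          (∃ K : ℝ, 0 ≤ K ∧ ∀ x y : M, ‖f x - f y‖ ≤ K * dist x y) ∧
          g = fun x => ∑ j, φ j x • f (p j)}) ∧
      (∀ f : M → B, (∃ K : ℝ, 0 ≤ K ∧ ∀ x y : M, ‖f x - f y‖ ≤ K * dist x y) →
        (⨆ x : M, ‖f x - ∑ j, φ j x • f (p j)‖) ≤ ε * lipConst f) := by
  obtain ⟨k, p, φ, hL, h01, hsum, hsupp⟩ := exists_lipschitz_partition_of_unity (M := M) hε
  refine ⟨k, p, φ, hL, h01, hsum, ?_, fun f hf => ?_⟩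
  · let T : (Fin k → B) →ₗ[ℂ] (M → B) :=
      { toFun := fun c x => ∑ j, φ j x • c j
        map_add' := fun c d => by
          ext x
          simp [Finset.sum_add_distrib]
        map_smul' := fun a c => by
          ext x
          simp [Finset.smul_sum, smul_comm a] }
    refine Submodule.finiteDimensional_of_le (S₂ := LinearMap.range T) (Submodule.span_le.2 ?_)
    rintro _ ⟨f, -, rfl⟩
    exact ⟨fun j => f (p j), rfl⟩
  · refine Real.iSup_le (fun x => ?_) (mul_nonneg hε.le (lipConst_nonneg f))
    calc ‖f x - ∑ j, φ j x • f (p j)‖ = ‖∑ j, φ j x • (f x - f (p j))‖ := by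
          simp [smul_sub, Finset.sum_sub_distrib, ← Finset.sum_smul, hsum]
      _ ≤ ∑ j, φ j x * (ε * lipConst f) := norm_sum_le_of_le _ fun j _ => by
          rw [norm_smul, Real.norm_of_nonneg (h01 j x).1]
          rcases eq_or_ne (φ j x) 0 with h | h
          · simp [h]
          · refine mul_le_mul_of_nonneg_left ?_ (h01 j x).1
            rw [mul_comm ε]
            exact (norm_sub_le_lipConst_mul_dist hf x (p j)).trans
              (mul_le_mul_of_nonneg_left (hsupp j x h) (lipConst_nonneg f))
      _ = ε * lipConst f := by rw [← Finset.sum_mul, hsum, one_mul]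
end

section
/- Let 𝒳 ⊆ A be an operator system, let L be a Lipschitz seminorm on 𝒳, and let ε, C > 0. Suppose (ι,Φ) is an (ε,C)-approximation of (𝒳,L) with values in an operator system 𝒴 ⊆ B, and suppose there exist a norm N on the quotient Φ(𝒳)/ℂ·1_B and a constant D ≥ 0 such that N([Φ(x)]) ≤ D·L(x) for all x ∈ 𝒳. Then (𝒳,L) has finite diameter. -/
/-- On a finite-dimensional space, every linear map into a normed space is bounded with respect to
any definite seminorm. -/
theorem LinearMap.exists_bound_of_definite_seminorm {E F : Type*} [AddCommGroup E] [Module ℂ E]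
    [FiniteDimensional ℂ E] [NormedAddCommGroup F] [NormedSpace ℂ F]
    (p : Seminorm ℂ E) (hp : ∀ x, p x = 0 → x = 0) (f : E →ₗ[ℂ] F) :
    ∃ K : ℝ, 0 ≤ K ∧ ∀ x, ‖f x‖ ≤ K * p x := by
  let _ : Norm E := ⟨p⟩
  have core : NormedSpace.Core ℂ E :=
    { norm_nonneg := apply_nonneg p
      norm_smul := map_smul_eq_mul p
      norm_triangle := map_add_le_add p
      norm_eq_zero_iff := fun x => ⟨hp x, fun h => by rw [h]; exact map_zero p⟩ }
  let _ : NormedAddCommGroup E := NormedAddCommGroup.ofCore core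
  let _ : NormedSpace ℂ E := NormedSpace.ofCore core
  exact ⟨‖f.toContinuousLinearMap‖, norm_nonneg _, f.toContinuousLinearMap.le_opNorm⟩


/-- Let `𝒳 ⊆ A` be an operator system, let `L` be a Lipschitz seminorm on
`𝒳`, and let `ε, C > 0`.  Suppose `(ι,Φ)` is an `(ε,C)`-approximation of `(𝒳,L)` with values in
an operator system `𝒴 ⊆ B`, and suppose there exist a norm `N` on the quotient `Φ(𝒳)/ℂ·1_B` and
a constant `D ≥ 0` with `N([Φ(x)]) ≤ D·L(x)` for all `x ∈ 𝒳`.  Then `(𝒳,L)` has finite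
diameter, i.e. there is `C' ≥ 0` with `‖[x]‖_{𝒳/ℂ} ≤ C'·L(x)` for all `x ∈ 𝒳`.

Operator systems are encoded as unital star-invariant subspaces `X ⊆ A` of a unital C*-algebra,
seminorms and linear maps are defined on the ambient algebra with all conditions imposed only on
the operator system, and the norm `N` on the quotient `Φ(𝒳)/ℂ·1_B` is encoded as a function on
`B` which, on the image `Φ(𝒳)`, is `*`-homogeneous, subadditive, invariant under adding scalar
multiples of the unit (so that it descends to the quotient) and definite modulo the scalars.
The quotient norm `‖[x]‖_{𝒳/ℂ}` is written as `⨅ c : ℂ, ‖x - c•1‖`. -/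
theorem finite_diameter_of_approximation_with_quotient_norm
    {A : Type*} [CStarAlgebra A] {B : Type*} [CStarAlgebra B]
    (X : Submodule ℂ A) (hX_one : (1 : A) ∈ X) (hX_star : ∀ x ∈ X, star x ∈ X)
    (L : A → ℝ)
    (hL_add : ∀ x ∈ X, ∀ y ∈ X, L (x + y) ≤ L x + L y)
    (hL_smul : ∀ (c : ℂ), ∀ x ∈ X, L (c • x) = ‖c‖ * L x)
    (hL_star : ∀ x ∈ X, L (star x) = L x)
    (hL_one : L (1 : A) = 0)
    (ε C : ℝ) (hε : 0 < ε) (hC : 0 < C)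
    (Y : Submodule ℂ B) (hY_one : (1 : B) ∈ Y) (hY_star : ∀ y ∈ Y, star y ∈ Y)
    (ι Φ : A →ₗ[ℂ] B)
    (hmem : ∀ x ∈ X, ι x ∈ Y ∧ Φ x ∈ Y)
    (hι_one : ι 1 = 1) (hΦ_one : Φ 1 = 1)
    (hι_bdd : ∃ M : ℝ, ∀ x ∈ X, ‖ι x‖ ≤ M * ‖x‖)
    (hΦ_bdd : ∃ M : ℝ, ∀ x ∈ X, ‖Φ x‖ ≤ M * ‖x‖)
    (hι_below : ∀ x ∈ X, (1 / C) * ‖x‖ ≤ ‖ι x‖)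
    (hΦ_fin : FiniteDimensional ℂ (Submodule.span ℂ (Φ '' X)))
    (happrox : ∀ x ∈ X, ‖ι x - Φ x‖ ≤ ε * L x)
    -- `N` is a norm on the quotient `Φ(𝒳)/ℂ·1_B`:
    (N : B → ℝ)
    (hN_add : ∀ x ∈ X, ∀ y ∈ X, N (Φ x + Φ y) ≤ N (Φ x) + N (Φ y))
    (hN_smul : ∀ (c : ℂ), ∀ x ∈ X, N (c • Φ x) = ‖c‖ * N (Φ x))
    (hN_quot : ∀ x ∈ X, ∀ c : ℂ, N (Φ x + c • (1 : B)) = N (Φ x))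
    (hN_def : ∀ x ∈ X, N (Φ x) = 0 → ∃ c : ℂ, Φ x = c • (1 : B))
    (D : ℝ) (hD : 0 ≤ D)
    (hND : ∀ x ∈ X, N (Φ x) ≤ D * L x) :
    ∃ C' : ℝ, 0 ≤ C' ∧ ∀ x ∈ X, (⨅ c : ℂ, ‖x - c • (1 : A)‖) ≤ C' * L x := by
  have hV : FiniteDimensional ℂ (X.map Φ) := by
    rwa [← Submodule.map_coe, Submodule.span_eq] at hΦ_fin
  obtain ⟨W, hW⟩ := Submodule.exists_isCompl (ℂ ∙ (1 : B))
  have hW_mem : ∀ w : (X.map Φ ⊓ W : Submodule ℂ B), ∃ x ∈ X, Φ x = w :=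
    fun w => w.2.1
  have : FiniteDimensional ℂ (X.map Φ ⊓ W : Submodule ℂ B) :=
    Submodule.finiteDimensional_inf_left _ _
  let p : Seminorm ℂ (X.map Φ ⊓ W : Submodule ℂ B) := Seminorm.of (fun w => N w)
    (fun v w => by
      obtain ⟨x, hx, hxv⟩ := hW_mem v
      obtain ⟨y, hy, hyw⟩ := hW_mem w
      simpa [hxv, hyw] using hN_add x hx y hy)
    (fun c w => by
      obtain ⟨x, hx, hxw⟩ := hW_mem w
      simpa [hxw] using hN_smul c x hx)
  have hp : ∀ w, p w = 0 → w = 0 := by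
    intro w hw
    obtain ⟨x, hx, hxw⟩ := hW_mem w
    have hNw : N w = 0 := hw
    obtain ⟨c, hc⟩ := hN_def x hx (hxw ▸ hNw)
    refine Subtype.ext (Submodule.disjoint_def.mp hW.disjoint _ ?_ w.2.2)
    exact Submodule.mem_span_singleton.mpr ⟨c, by rw [← hc, hxw]⟩
  obtain ⟨K, hK, hbound⟩ :=
    LinearMap.exists_bound_of_definite_seminorm p hp (Submodule.subtype _)
  refine ⟨C * (ε + K * D), by positivity, fun x hx => ?_⟩
  obtain ⟨u, hu, w, hw, huw⟩ := Submodule.mem_sup.mp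
    (hW.sup_eq_top ▸ Submodule.mem_top : Φ x ∈ (ℂ ∙ (1 : B)) ⊔ W)
  obtain ⟨c, rfl⟩ := Submodule.mem_span_singleton.mp hu
  have hxc : x - c • (1 : A) ∈ X := X.sub_mem hx (X.smul_mem c hX_one)
  have hΦw : Φ (x - c • (1 : A)) = w := by
    rw [map_sub, map_smul, hΦ_one, ← huw, add_sub_cancel_left]
  have hNw : N w = N (Φ x) := by
    rw [← huw, add_comm, ← hΦw, hN_quot _ hxc]
  have hw_norm : ‖w‖ ≤ K * (D * L x) :=
    (hbound ⟨w, ⟨_, hxc, hΦw⟩, hw⟩).trans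
      (mul_le_mul_of_nonneg_left (hNw.trans_le (hND x hx)) hK)
  have hι : ‖ι (x - c • (1 : A))‖ ≤ ε * L x + K * (D * L x) := by
    have h : ι (x - c • (1 : A)) = (ι x - Φ x) + w := by
      rw [map_sub, map_smul, hι_one, ← huw]
      abel
    rw [h]
    exact (norm_add_le _ _).trans (add_le_add (happrox x hx) hw_norm)
  calc (⨅ c : ℂ, ‖x - c • (1 : A)‖) ≤ ‖x - c • (1 : A)‖ :=
        ciInf_le ⟨0, by rintro _ ⟨d, rfl⟩; exact norm_nonneg _⟩ c
    _ = C * ((1 / C) * ‖x - c • (1 : A)‖) := by field_simp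
    _ ≤ C * (ε * L x + K * (D * L x)) :=
        mul_le_mul_of_nonneg_left ((hι_below _ hxc).trans hι) hC.le
    _ = C * (ε + K * D) * L x := by ring
end

section
/- Let 𝒳 ⊆ A be an operator system and let L be a Lipschitz seminorm on 𝒳 whose kernel {x ∈ 𝒳 : L(x) = 0} equals ℂ·1_A. Suppose (ι,Φ) is an (ε,C)-approximation of (𝒳,L) for some constants ε, C > 0 such that the codomain of both ι and Φ is 𝒳 itself, and suppose Φ is bounded with respect to L, i.e. there exists D ≥ 0 with L(Φ(x)) ≤ D·L(x) for all x ∈ 𝒳. Then (𝒳,L) has finite diameter. -/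
/-- On a finite-dimensional space, every seminorm is dominated by a multiple of any definite
seminorm. -/
theorem Seminorm.exists_le_mul_of_finiteDimensional {E : Type*} [AddCommGroup E] [Module ℂ E]
    [FiniteDimensional ℂ E] (p q : Seminorm ℂ E) (hp : ∀ x, p x = 0 → x = 0) :
    ∃ K : ℝ, 0 ≤ K ∧ ∀ x, q x ≤ K * p x := by
  let : Norm E := ⟨p⟩
  have core : NormedSpace.Core ℂ E :=
    { norm_nonneg := fun x => apply_nonneg p x
      norm_smul := fun c x => map_smul_eq_mul p c x
      norm_triangle := fun x y => map_add_le_add p x y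
      norm_eq_zero_iff := fun x => ⟨hp x, fun h => by rw [h]; exact map_zero p⟩ }
  let : NormedAddCommGroup E := NormedAddCommGroup.ofCore core
  let : NormedSpace ℂ E := NormedSpace.ofCore core
  let b := Module.finBasis ℂ E
  let f := fun i => LinearMap.toContinuousLinearMap (b.coord i)
  refine ⟨∑ i, ‖f i‖ * q (b i), by positivity, fun x => ?_⟩
  calc q x = q (∑ i, f i x • b i) := by
        congr 1
        exact (b.sum_repr x).symm
    _ ≤ ∑ i, q (f i x • b i) := by
        exact Finset.le_sum_of_subadditive q (map_zero q).le (map_add_le_add q) _ _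
    _ ≤ ∑ i, ‖f i‖ * q (b i) * p x := by
        refine Finset.sum_le_sum fun i _ => ?_
        rw [map_smul_eq_mul, mul_right_comm]
        exact mul_le_mul_of_nonneg_right ((f i).le_opNorm x) (apply_nonneg q _)
    _ = (∑ i, ‖f i‖ * q (b i)) * p x := (Finset.sum_mul _ _ _).symm

/-- Let `𝒳 ⊆ A` be an operator system and let `L` be a Lipschitz seminorm on
`𝒳` whose kernel equals `ℂ·1_A`.  Suppose `(ι,Φ)` is an `(ε,C)`-approximation of `(𝒳,L)` for
some `ε, C > 0` such that the codomain of both `ι` and `Φ` is `𝒳` itself, and suppose `Φ` is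
bounded with respect to `L`, i.e. there is `D ≥ 0` with `L(Φ(x)) ≤ D·L(x)` for all `x ∈ 𝒳`.
Then `(𝒳,L)` has finite diameter.

Operator systems are encoded as unital star-invariant subspaces `X ⊆ A` of a unital C*-algebra;
seminorms and linear maps are defined on the ambient algebra with all conditions imposed only on
the operator system, and the quotient norm `‖[x]‖_{𝒳/ℂ}` is written `⨅ c : ℂ, ‖x - c•1‖`. -/
theorem finite_diameter_of_approximation_with_L_bounded_map
    {A : Type*} [CStarAlgebra A]
    (X : Submodule ℂ A) (hX_one : (1 : A) ∈ X) (hX_star : ∀ x ∈ X, star x ∈ X)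
    (L : A → ℝ)
    (hL_add : ∀ x ∈ X, ∀ y ∈ X, L (x + y) ≤ L x + L y)
    (hL_smul : ∀ (c : ℂ), ∀ x ∈ X, L (c • x) = ‖c‖ * L x)
    (hL_star : ∀ x ∈ X, L (star x) = L x)
    (hL_one : L (1 : A) = 0)
    (hL_ker : ∀ x ∈ X, L x = 0 → ∃ c : ℂ, x = c • (1 : A))
    (ε C : ℝ) (hε : 0 < ε) (hC : 0 < C)
    (ι Φ : A →ₗ[ℂ] A)
    (hmem : ∀ x ∈ X, ι x ∈ X ∧ Φ x ∈ X)
    (hι_one : ι 1 = 1) (hΦ_one : Φ 1 = 1)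
    (hι_bdd : ∃ M : ℝ, ∀ x ∈ X, ‖ι x‖ ≤ M * ‖x‖)
    (hΦ_bdd : ∃ M : ℝ, ∀ x ∈ X, ‖Φ x‖ ≤ M * ‖x‖)
    (hι_below : ∀ x ∈ X, (1 / C) * ‖x‖ ≤ ‖ι x‖)
    (hΦ_fin : FiniteDimensional ℂ (Submodule.span ℂ (Φ '' X)))
    (happrox : ∀ x ∈ X, ‖ι x - Φ x‖ ≤ ε * L x)
    (D : ℝ) (hD : 0 ≤ D)
    (hΦ_L_bdd : ∀ x ∈ X, L (Φ x) ≤ D * L x) :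
    ∃ C' : ℝ, 0 ≤ C' ∧ ∀ x ∈ X, (⨅ c : ℂ, ‖x - c • (1 : A)‖) ≤ C' * L x := by
  have hL_neg : ∀ x ∈ X, L (-x) = L x := fun x hx => by
    simpa using hL_smul (-1) x hx
  have hL_zero : L 0 = 0 := by simpa using hL_smul 0 1 hX_one
  have hL_nonneg : ∀ x ∈ X, 0 ≤ L x := fun x hx => by
    have h := hL_add x hx (-x) (X.neg_mem hx)
    rw [add_neg_cancel, hL_zero, hL_neg x hx] at h
    linarith
  have hL_sub : ∀ x ∈ X, ∀ c : ℂ, L (x - c • 1) ≤ L x := fun x hx c => by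
    have h := hL_add x hx ((-c) • 1) (X.smul_mem _ hX_one)
    rw [hL_smul _ _ hX_one, hL_one, mul_zero, add_zero, neg_smul, ← sub_eq_add_neg] at h
    exact h
  let V := Submodule.span ℂ (Φ '' X)
  have hVX : V ≤ X := Submodule.span_le.2 (by
    rintro _ ⟨x, hx, rfl⟩
    exact (hmem x hx).2)
  have h1V : (1 : A) ∈ V := Submodule.subset_span ⟨1, hX_one, hΦ_one⟩
  obtain ⟨W', hW'⟩ := Submodule.exists_isCompl (Submodule.span ℂ {(1 : A)})
  let W : Submodule ℂ A := W' ⊓ V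
  have : FiniteDimensional ℂ W := Submodule.finiteDimensional_of_le (inf_le_right : W ≤ V)
  have hWX : ∀ w : W, (w : A) ∈ X := fun w => hVX w.2.2
  let p : Seminorm ℂ W := Seminorm.of (fun w => L w)
    (fun x y => hL_add x (hWX x) y (hWX y)) (fun c x => hL_smul c x (hWX x))
  obtain ⟨K, hK, hKp⟩ := Seminorm.exists_le_mul_of_finiteDimensional p (normSeminorm ℂ W) (by
    intro w hw
    obtain ⟨c, hc⟩ := hL_ker w (hWX w) hw
    exact Subtype.ext (Submodule.disjoint_def.1 hW'.disjoint w
      (Submodule.mem_span_singleton.2 ⟨c, hc.symm⟩) w.2.1))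
  refine ⟨C * (ε + K * D), by positivity, fun x hx => ?_⟩
  have hΦV : Φ x ∈ V := Submodule.subset_span ⟨x, hx, rfl⟩
  obtain ⟨a, ha, w, hw, haw⟩ := Submodule.mem_sup.1
    (hW'.sup_eq_top ▸ Submodule.mem_top : Φ x ∈ Submodule.span ℂ {(1 : A)} ⊔ W')
  obtain ⟨c, rfl⟩ := Submodule.mem_span_singleton.1 ha
  have hw_eq : w = Φ x - c • 1 := eq_sub_of_add_eq' haw
  have hwV : w ∈ V := hw_eq ▸ V.sub_mem hΦV (V.smul_mem c h1V)
  have hKw : ‖Φ x - c • 1‖ ≤ K * (D * L x) := by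
    rw [← hw_eq]
    refine (hKp ⟨w, hw, hwV⟩).trans (mul_le_mul_of_nonneg_left ?_ hK)
    change L w ≤ D * L x
    rw [hw_eq]
    exact (hL_sub _ (hmem x hx).2 c).trans (hΦ_L_bdd x hx)
  have hιx : ‖ι (x - c • 1)‖ ≤ ε * L x + K * (D * L x) := by
    have : ι (x - c • 1) = (ι x - Φ x) + (Φ x - c • 1) := by
      rw [map_sub, map_smul, hι_one]
      abel
    rw [this]
    exact (norm_add_le _ _).trans (add_le_add (happrox x hx) hKw)
  have hlow := (hι_below _ (X.sub_mem hx (X.smul_mem c hX_one))).trans hιx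
  rw [one_div, inv_mul_le_iff₀ hC] at hlow
  calc (⨅ c : ℂ, ‖x - c • (1 : A)‖) ≤ ‖x - c • 1‖ :=
        ciInf_le ⟨0, by rintro _ ⟨c, rfl⟩; exact norm_nonneg _⟩ c
    _ ≤ C * (ε * L x + K * (D * L x)) := hlow
    _ = C * (ε + K * D) * L x := by ring
end

section
/- Let A be a unital C*-algebra and let γ ∈ A satisfy γ* = γ and γ² = 1. If s, t ∈ A satisfy γ·s = −s·γ and γ·t = t·γ, then ‖s‖ ≤ ‖s + γ·t‖ and ‖t‖ ≤ ‖s + γ·t‖. -/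
/-- If `x + y` and `x - y` have the same norm, then `x` is no larger than `x + y`. -/
theorem norm_le_norm_add_of_norm_sub_eq {E : Type*} [NormedAddCommGroup E] [NormedSpace ℝ E]
    {x y : E} (h : ‖x - y‖ = ‖x + y‖) : ‖x‖ ≤ ‖x + y‖ := by
  have hx : (2 : ℝ) • x = (x + y) + (x - y) := by rw [two_smul]; abel
  have key := norm_add_le (x + y) (x - y)
  rw [← hx, norm_smul, h, Real.norm_ofNat] at key
  linarith

/-- Let `A` be a unital C*-algebra and let `γ ∈ A` satisfy `γ* = γ` and
`γ² = 1`.  If `s, t ∈ A` satisfy `γ·s = −s·γ` and `γ·t = t·γ`, then `‖s‖ ≤ ‖s + γ·t‖` and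
`‖t‖ ≤ ‖s + γ·t‖`. -/
theorem external_product_grading_estimate {A : Type*} [CStarAlgebra A]
    (γ s t : A) (hγstar : star γ = γ) (hγsq : γ ^ 2 = 1)
    (hs : γ * s = -(s * γ)) (ht : γ * t = t * γ) :
    ‖s‖ ≤ ‖s + γ * t‖ ∧ ‖t‖ ≤ ‖s + γ * t‖ := by
  have hγγ : γ * γ = 1 := by rw [← pow_two, hγsq]
  have hγ : γ ∈ unitary A := by
    rw [Unitary.mem_iff, hγstar]
    exact ⟨hγγ, hγγ⟩
  have hconj : γ * (s + γ * t) * γ = -(s - γ * t) := by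
    rw [mul_add, hs, ht, ← mul_assoc, ht, add_mul, neg_mul, mul_assoc s, mul_assoc (t * γ), hγγ]
    rw [mul_one, mul_one]
    abel
  have hnorm : ‖s - γ * t‖ = ‖s + γ * t‖ := by
    rw [← norm_neg, ← hconj, CStarRing.norm_mul_mem_unitary _ hγ,
      CStarRing.norm_mem_unitary_mul _ hγ]
  refine ⟨norm_le_norm_add_of_norm_sub_eq hnorm, ?_⟩
  rw [← CStarRing.norm_mem_unitary_mul t hγ, add_comm s]
  apply norm_le_norm_add_of_norm_sub_eq
  rw [norm_sub_rev, hnorm, add_comm]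
end

section
/- Let A be a unital C*-algebra and let u, v ∈ A be selfadjoint unitaries (u* = u, v* = v, u² = 1 = v²) with u·v = −v·u. If a, b ∈ A commute with both u and v (u·a = a·u, v·a = a·v, u·b = b·u, v·b = b·v), then ‖a‖ ≤ ‖u·a + v·b‖ and ‖b‖ ≤ ‖u·a + v·b‖. -/
/-- If `u` is a selfadjoint unitary anticommuting with `v`, then `u * a` is the part of
`u * a + v * b` fixed by conjugation with `u`, so its norm is dominated by that of the sum. -/
theorem norm_le_norm_mul_add_mul_of_anticommute {A : Type*} [CStarAlgebra A]
    {u v a b : A} (hustar : star u = u) (husq : u ^ 2 = 1) (huv : u * v = -(v * u))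
    (hua : u * a = a * u) (hub : u * b = b * u) :
    ‖a‖ ≤ ‖u * a + v * b‖ := by
  have huu : u * u = 1 := by rw [← sq, husq]
  have hu : u ∈ unitary A := by simp [Unitary.mem_iff, hustar, huu]
  have hconj : u * (u * a + v * b) * u = u * a - v * b := by
    calc u * (u * a + v * b) * u = u * u * (a * u) + u * v * (b * u) := by noncomm_ring
      _ = u * u * (u * a) + -(v * u) * (u * b) := by rw [← hua, ← hub, huv]
      _ = u * u * (u * a) - v * (u * u) * b := by noncomm_ring
      _ = u * a - v * b := by rw [huu, one_mul, mul_one]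
  have hnorm : ‖u * a - v * b‖ = ‖u * a + v * b‖ := by
    rw [← hconj, CStarRing.norm_mul_mem_unitary _ hu, CStarRing.norm_mem_unitary_mul _ hu]
  have hsum : (u * a + v * b) + (u * a - v * b) = (2 : ℝ) • (u * a) := by
    rw [two_smul]; abel
  have hle := norm_add_le (u * a + v * b) (u * a - v * b)
  rw [hsum, norm_smul, hnorm, CStarRing.norm_mem_unitary_mul a hu, Real.norm_ofNat] at hle
  linarith


/-- Let `A` be a unital C*-algebra and let `u, v ∈ A` be selfadjoint unitaries
(`u* = u`, `v* = v`, `u² = 1 = v²`) with `u·v = −v·u`.  If `a, b ∈ A` commute with both `u` and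
`v`, then `‖a‖ ≤ ‖u·a + v·b‖` and `‖b‖ ≤ ‖u·a + v·b‖`. -/
theorem external_product_pauli_estimate {A : Type*} [CStarAlgebra A]
    (u v a b : A) (hustar : star u = u) (hvstar : star v = v)
    (husq : u ^ 2 = 1) (hvsq : v ^ 2 = 1) (huv : u * v = -(v * u))
    (hua : u * a = a * u) (hva : v * a = a * v)
    (hub : u * b = b * u) (hvb : v * b = b * v) :
    ‖a‖ ≤ ‖u * a + v * b‖ ∧ ‖b‖ ≤ ‖u * a + v * b‖ := by
  refine ⟨norm_le_norm_mul_add_mul_of_anticommute hustar husq huv hua hub, ?_⟩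
  rw [add_comm]
  exact norm_le_norm_mul_add_mul_of_anticommute hvstar hvsq (by rw [huv, neg_neg]) hvb hva
end
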